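/- arXiv:1101.3352 — 2 statements merged into one kernel-verified Lean document; each statement's English description precedes it below -/
import Mathlib

section
/- If a random vector X in ℝⁿ has a log-concave density f, then for every ε with 0 ≤ ε ≤ 2, the probability P( | (−log f(X))/n − h(X)/n | ≥ ε ) is at most 4 e^{−ε² n / 16}. -/
open MeasureTheory ProbabilityTheory Real Pointwise

/-- A nonnegative function on ℝⁿ is log-concave if
`f(tx + (1-t)y) ≥ f(x)^t f(y)^(1-t)` for all `x, y` and `t ∈ [0,1]`. -/
def IsLogConcave {n : ℕ} (f : EuclideanSpace ℝ (Fin n) → ℝ) : Prop :=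
  (∀ x, 0 ≤ f x) ∧
  ∀ x y : EuclideanSpace ℝ (Fin n), ∀ t : ℝ, 0 ≤ t → t ≤ 1 →
    f x ^ t * f y ^ (1 - t) ≤ f (t • x + (1 - t) • y)

/-- The Shannon differential entropy `h(f) = -∫ f log f` of a density `f` on ℝⁿ. -/
noncomputable def hEnt {n : ℕ} (f : EuclideanSpace ℝ (Fin n) → ℝ) : ℝ :=
  -∫ x, f x * Real.log (f x)



theorem bm_compact {a b : ℝ} (ha : 0 < a) (hb : 0 < b) {K L C : Set ℝ}
    (hK : IsCompact K) (hL : IsCompact L) (hKn : K.Nonempty) (hLn : L.Nonempty)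
    (h : ∀ x ∈ K, ∀ y ∈ L, a * x + b * y ∈ C) :
    ENNReal.ofReal a * volume K + ENNReal.ofReal b * volume L ≤ volume C := by
  obtain ⟨p, hp⟩ := hK.exists_isGreatest hKn
  obtain ⟨q, hq⟩ := hL.exists_isLeast hLn
  have key : ∀ (c d : ℝ) (S : Set ℝ), 0 < c →
      volume ((fun x => c * x + d) '' S) = ENNReal.ofReal c * volume S := by
    intro c d S hc
    have : (fun x => c * x + d) '' S = (fun x => x + d) '' (c • S) := by
      ext z; simp [Set.mem_smul_set, eq_add_neg_iff_add_eq]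
    rw [this, Set.image_add_right, measure_preimage_add_right, Measure.addHaar_smul]
    simp [abs_of_pos hc]
  rw [← key a (b * q) K ha, ← key b (a * p) L hb]
  have hLc : IsCompact ((fun x => b * x + a * p) '' L) := hL.image (by fun_prop)
  rw [← measure_union₀ hLc.measurableSet.nullMeasurableSet]
  · apply measure_mono
    rintro z (⟨x, hx, rfl⟩ | ⟨y, hy, rfl⟩)
    · exact h x hx q hq.1
    · have := h p hp.1 y hy
      simpa [add_comm] using this
  · refine measure_mono_null (t := {a * p + b * q}) ?_ (by simp)
    rintro z ⟨⟨x, hx, rfl⟩, ⟨y, hy, hxy⟩⟩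
    have h1 := hp.2 hx
    have h2 := hq.2 hy
    simp only [Set.mem_singleton_iff] at *
    have h3 : a * x ≤ a * p := by gcongr
    have h4 : b * q ≤ b * y := by gcongr
    linarith

theorem bm_meas {a b : ℝ} (ha : 0 < a) (hb : 0 < b) {A B C : Set ℝ}
    (hA : MeasurableSet A) (hB : MeasurableSet B) (hAn : A.Nonempty) (hBn : B.Nonempty)
    (h : ∀ x ∈ A, ∀ y ∈ B, a * x + b * y ∈ C) :
    ENNReal.ofReal a * volume A + ENNReal.ofReal b * volume B ≤ volume C := by
  obtain ⟨p, hp⟩ := hAn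
  obtain ⟨q, hq⟩ := hBn
  rw [hA.measure_eq_iSup_isCompact, hB.measure_eq_iSup_isCompact]
  simp only [ENNReal.mul_iSup, iSup_and']
  refine ENNReal.biSup_add_biSup_le' ⟨∅, by simp⟩ ⟨∅, by simp⟩ ?_
  rintro K ⟨hKA, hK⟩ L ⟨hLB, hL⟩
  refine le_trans ?_ (bm_compact ha hb (hK.insert p) (hL.insert q) (by simp) (by simp) (C := C) ?_)
  · gcongr <;> simp
  · intro x hx y hy
    exact h x (Set.insert_subset hp hKA hx) y (Set.insert_subset hq hLB hy)

theorem layer {u : ℝ → ENNReal} (hu : Measurable u) :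
    ∫⁻ x, min (u x) 1 = ∫⁻ t in Set.Ioo (0:ℝ) 1, volume {x | ENNReal.ofReal t < u x} := by
  have h0 : ∀ x, min (u x) 1 ≠ ⊤ := fun x => ne_top_of_le_ne_top ENNReal.one_ne_top (min_le_right _ _)
  have h1 := lintegral_eq_lintegral_meas_lt (volume : Measure ℝ) (f := fun x => (min (u x) 1).toReal)
    (Filter.Eventually.of_forall fun x => ENNReal.toReal_nonneg) (by fun_prop)
  simp only [ENNReal.ofReal_toReal (h0 _)] at h1
  rw [h1, ← Set.Ioo_union_Ici_eq_Ioi (zero_lt_one (α := ℝ)), lintegral_union measurableSet_Ici]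
  · have : ∫⁻ t in Set.Ici (1:ℝ), volume {x | t < (min (u x) 1).toReal} = 0 := by
      rw [setLIntegral_congr_fun (g := fun _ => 0) measurableSet_Ici]
      · simp
      · intro t ht
        have : {x | t < (min (u x) 1).toReal} = ∅ := by
          ext x
          simp only [Set.mem_ofPred_eq, Set.mem_empty_iff_false, iff_false, not_lt]
          refine le_trans ?_ ht
          have := ENNReal.toReal_mono ENNReal.one_ne_top (min_le_right (u x) 1)
          simpa using this
        simp only [this, measure_empty]
    rw [this, add_zero]
    refine setLIntegral_congr_fun measurableSet_Ioo ?_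
    intro t ht
    have : {x | t < (min (u x) 1).toReal} = {x | ENNReal.ofReal t < u x} := by
      ext x
      simp only [Set.mem_ofPred_eq]
      rw [← ENNReal.ofReal_lt_iff_lt_toReal ht.1.le (h0 x), lt_min_iff]
      simp [ht.2]
    simp only [this]
  · rw [Set.disjoint_left]
    intro x hx hx'
    exact absurd hx.2 (not_lt.2 hx')

theorem pl_norm {a b : ℝ} (ha : 0 < a) (hb : 0 < b) (hab : a + b = 1)
    {f g h : ℝ → ENNReal} (hf : Measurable f) (hg : Measurable g) (hh : Measurable h)
    (hf1 : ⨆ x, f x = 1) (hg1 : ⨆ x, g x = 1)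
    (H : ∀ x y, f x ^ a * g y ^ b ≤ h (a * x + b * y)) :
    ENNReal.ofReal a * (∫⁻ x, f x) + ENNReal.ofReal b * (∫⁻ x, g x) ≤ ∫⁻ x, h x := by
  have hf2 : ∀ x, min (f x) 1 = f x := fun x => min_eq_left (hf1 ▸ le_iSup f x)
  have hg2 : ∀ x, min (g x) 1 = g x := fun x => min_eq_left (hg1 ▸ le_iSup g x)
  have Hf := layer hf
  have Hg := layer hg
  have Hh := layer hh
  simp only [hf2] at Hf
  simp only [hg2] at Hg
  calc _ = ∫⁻ t in Set.Ioo (0:ℝ) 1, (ENNReal.ofReal a * volume {x | ENNReal.ofReal t < f x} +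
        ENNReal.ofReal b * volume {x | ENNReal.ofReal t < g x}) := by
        have mm : ∀ u : ℝ → ENNReal, Measurable fun t : ℝ => volume {x | ENNReal.ofReal t < u x} := by
          intro u
          apply Antitone.measurable
          intro s t hst
          apply measure_mono
          intro x hx
          exact lt_of_le_of_lt (ENNReal.ofReal_le_ofReal hst) hx
        rw [lintegral_add_left ((mm f).const_mul _), lintegral_const_mul _ (mm f),
          lintegral_const_mul _ (mm g), Hf, Hg]
    _ ≤ ∫⁻ t in Set.Ioo (0:ℝ) 1, volume {x | ENNReal.ofReal t < h x} := by
        refine setLIntegral_mono' measurableSet_Ioo ?_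
        intro t ht
        have ht1 : ENNReal.ofReal t < 1 := by simp [ht.2]
        refine bm_meas ha hb (measurableSet_lt measurable_const hf)
          (measurableSet_lt measurable_const hg) ?_ ?_ ?_
        · exact lt_iSup_iff.1 (hf1 ▸ ht1)
        · exact lt_iSup_iff.1 (hg1 ▸ ht1)
        · intro x hx y hy
          refine lt_of_lt_of_le ?_ (H x y)
          have e : ENNReal.ofReal t = ENNReal.ofReal t ^ a * ENNReal.ofReal t ^ b := by
            rw [← ENNReal.rpow_add_of_nonneg _ _ ha.le hb.le, hab, ENNReal.rpow_one]
          rw [e]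
          exact ENNReal.mul_lt_mul (ENNReal.rpow_lt_rpow hx ha) (ENNReal.rpow_lt_rpow hy hb)
    _ = ∫⁻ x, min (h x) 1 := Hh.symm
    _ ≤ _ := lintegral_mono fun x => min_le_left _ _

theorem amgm {a b : ℝ} (ha : 0 < a) (hb : 0 < b) (hab : a + b = 1) (x y : ENNReal) :
    x ^ a * y ^ b ≤ ENNReal.ofReal a * x + ENNReal.ofReal b * y := by
  by_cases hx : x = ⊤
  · simp [hx, ENNReal.mul_top, ha]
  by_cases hy : y = ⊤
  · simp [hy, ENNReal.mul_top, hb]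
  lift x to NNReal using hx
  lift y to NNReal using hy
  have := NNReal.geom_mean_le_arith_mean2_weighted a.toNNReal b.toNNReal x y
    (by rw [← Real.toNNReal_add ha.le hb.le, hab]; simp)
  simp only [Real.coe_toNNReal _ ha.le, Real.coe_toNNReal _ hb.le] at this
  rw [← ENNReal.coe_rpow_of_nonneg _ ha.le, ← ENNReal.coe_rpow_of_nonneg _ hb.le]
  simp only [ENNReal.ofReal]
  exact_mod_cast this

theorem pl_bdd {a b : ℝ} (ha : 0 < a) (hb : 0 < b) (hab : a + b = 1)
    {f g h : ℝ → ENNReal} (hf : Measurable f) (hg : Measurable g) (hh : Measurable h)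
    (hf1 : ⨆ x, f x ≠ ⊤) (hg1 : ⨆ x, g x ≠ ⊤)
    (H : ∀ x y, f x ^ a * g y ^ b ≤ h (a * x + b * y)) :
    (∫⁻ x, f x) ^ a * (∫⁻ x, g x) ^ b ≤ ∫⁻ x, h x := by
  by_cases hf0 : ⨆ x, f x = 0
  · have : ∀ x, f x = 0 := by simpa using hf0
    simp [this, ha]
  by_cases hg0 : ⨆ x, g x = 0
  · have : ∀ x, g x = 0 := by simpa using hg0
    simp [this, hb]
  set M := ⨆ x, f x with hM
  set N := ⨆ x, g x with hN
  have h1 := pl_norm ha hb hab (f := fun x => M⁻¹ * f x) (g := fun x => N⁻¹ * g x)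
    (h := fun x => (M⁻¹ ^ a * N⁻¹ ^ b) * h x) (by fun_prop) (by fun_prop) (by fun_prop)
    (by rw [← ENNReal.mul_iSup, ← hM, ENNReal.inv_mul_cancel hf0 hf1])
    (by rw [← ENNReal.mul_iSup, ← hN, ENNReal.inv_mul_cancel hg0 hg1])
    (by
      intro x y
      rw [ENNReal.mul_rpow_of_nonneg _ _ ha.le, ENNReal.mul_rpow_of_nonneg _ _ hb.le,
        mul_mul_mul_comm]
      gcongr
      exact H x y)
  have h2 := (amgm ha hb hab _ _).trans h1
  rw [lintegral_const_mul _ hf, lintegral_const_mul _ hg, lintegral_const_mul _ hh,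
    ENNReal.mul_rpow_of_nonneg _ _ ha.le, ENNReal.mul_rpow_of_nonneg _ _ hb.le,
        mul_mul_mul_comm] at h2
  clear_value M N
  refine (ENNReal.mul_le_mul_iff_right ?_ ?_).1 h2 <;> clear hM hN h1 h2
  · refine mul_ne_zero ?_ ?_ <;> simp [ENNReal.rpow_eq_zero_iff, *]
  · apply ENNReal.mul_ne_top <;> simp [ENNReal.rpow_eq_top_iff, *, ha.le, hb.le]

theorem pl_one {a b : ℝ} (ha : 0 < a) (hb : 0 < b) (hab : a + b = 1)
    {f g h : ℝ → ENNReal} (hf : Measurable f) (hg : Measurable g) (hh : Measurable h)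
    (H : ∀ x y, f x ^ a * g y ^ b ≤ h (a * x + b * y)) :
    (∫⁻ x, f x) ^ a * (∫⁻ x, g x) ^ b ≤ ∫⁻ x, h x := by
  by_cases hf0 : ∫⁻ x, f x = 0
  · simp [hf0, ha]
  by_cases hg0 : ∫⁻ x, g x = 0
  · simp [hg0, hb]
  have T : ∀ u : ℝ → ENNReal, Measurable u → Filter.Tendsto (fun n : ℕ => ∫⁻ x, min (u x) n)
      Filter.atTop (nhds (∫⁻ x, u x)) := by
    intro u hu
    apply lintegral_tendsto_of_tendsto_of_monotone
    · intro n; fun_prop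
    · refine Filter.Eventually.of_forall fun x => ?_
      intro m n hmn
      dsimp only
      gcongr
    · refine Filter.Eventually.of_forall fun x => ?_
      have := (tendsto_const_nhds (x := u x)).min ENNReal.tendsto_nat_nhds_top
      simpa using this
  refine le_of_tendsto (ENNReal.Tendsto.mul (((T f hf).ennrpow_const a)) (Or.inl ?_)
    (((T g hg).ennrpow_const b)) (Or.inl ?_)) (Filter.Eventually.of_forall fun n => ?_)
  · simp [ENNReal.rpow_eq_zero_iff, *, ha.not_gt]
  · simp [ENNReal.rpow_eq_zero_iff, *, hb.not_gt]
  · refine pl_bdd ha hb hab (by fun_prop) (by fun_prop) hh ?_ ?_ ?_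
    · exact ne_top_of_le_ne_top (ENNReal.natCast_ne_top n) (iSup_le fun x => min_le_right _ _)
    · exact ne_top_of_le_ne_top (ENNReal.natCast_ne_top n) (iSup_le fun x => min_le_right _ _)
    · intro x y
      refine le_trans ?_ (H x y)
      gcongr <;> exact min_le_left _ _

/-- Prekopa-Leindler property of a measure space. -/
def PLProp (E : Type) [AddCommGroup E] [Module ℝ E] [MeasureSpace E] : Prop :=
  ∀ (a b : ℝ), 0 < a → 0 < b → a + b = 1 → ∀ f g h : E → ENNReal, Measurable f → Measurable g →
    Measurable h → (∀ x y, f x ^ a * g y ^ b ≤ h (a • x + b • y)) →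
    (∫⁻ x, f x) ^ a * (∫⁻ x, g x) ^ b ≤ ∫⁻ x, h x

theorem PLProp.real : PLProp ℝ := fun _ _ ha hb hab _ _ _ hf hg hh H =>
  pl_one ha hb hab hf hg hh H

theorem PLProp.prod {E F : Type} [AddCommGroup E] [Module ℝ E] [MeasureSpace E]
    [AddCommGroup F] [Module ℝ F] [MeasureSpace F] [SFinite (volume : Measure F)]
    [SFinite (volume : Measure E)]
    (hE : PLProp E) (hF : PLProp F) : PLProp (E × F) := by
  intro a b ha hb hab f g h hf hg hh H
  rw [Measure.volume_eq_prod, lintegral_prod _ hf.aemeasurable, lintegral_prod _ hg.aemeasurable,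
    lintegral_prod _ hh.aemeasurable]
  refine hE a b ha hb hab _ _ _ hf.lintegral_prod_right' hg.lintegral_prod_right'
    hh.lintegral_prod_right' ?_
  intro x y
  refine hF a b ha hb hab _ _ _ (by fun_prop) (by fun_prop) (by fun_prop) ?_
  intro x' y'
  exact H (x, x') (y, y')

theorem PLProp.transfer {E F : Type} [AddCommGroup E] [Module ℝ E] [MeasureSpace E]
    [AddCommGroup F] [Module ℝ F] [MeasureSpace F]
    (hE : PLProp E) (φ : E → F) (hφ : MeasurePreserving φ)
    (hl : ∀ (a b : ℝ) x y, φ (a • x + b • y) = a • φ x + b • φ y) : PLProp F := by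
  intro a b ha hb hab f g h hf hg hh H
  rw [← hφ.lintegral_comp hf, ← hφ.lintegral_comp hg, ← hφ.lintegral_comp hh]
  have := hφ.measurable
  refine hE a b ha hb hab _ _ _ (by fun_prop) (by fun_prop) (by fun_prop) ?_
  intro x y
  rw [hl]
  exact H _ _

theorem PLProp.pi (n : ℕ) : PLProp (Fin n → ℝ) := by
  induction n with
  | zero =>
    intro a b ha hb hab f g h hf hg hh H
    rw [volume_pi, Measure.pi_of_empty _ default]
    simp only [lintegral_dirac]
    convert H default default using 2
  | succ n ih =>
    refine (PLProp.real.prod ih).transfer _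
      (volume_preserving_piFinSuccAbove (fun _ : Fin (n+1) => ℝ) 0).symm ?_
    intro a b x y
    ext i
    refine Fin.cases ?_ (fun j => ?_) i <;> simp [MeasurableEquiv.piFinSuccAbove]

theorem PLProp.euclidean (n : ℕ) : PLProp (EuclideanSpace ℝ (Fin n)) := by
  refine (PLProp.pi n).transfer _ (PiLp.volume_preserving_toLp (Fin n)) ?_
  intro a b x y
  rfl

theorem exists_measurable_version {n : ℕ} {f : EuclideanSpace ℝ (Fin n) → ℝ} (hf : IsLogConcave f) :
    ∃ g : EuclideanSpace ℝ (Fin n) → ℝ, IsLogConcave g ∧ Measurable g ∧ f =ᵐ[volume] g := by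
  obtain ⟨h0, h1⟩ := hf
  set S := {x | 0 < f x} with hS
  have hpos : ∀ x ∈ S, ∀ y ∈ S, ∀ a b : ℝ, 0 ≤ a → 0 ≤ b → a + b = 1 →
      f x ^ a * f y ^ b ≤ f (a • x + b • y) := by
    intro x _ y _ a b ha hb hab
    have e : b = 1 - a := by linarith
    subst e
    exact h1 x y a ha (by linarith)
  have hSc : Convex ℝ S := by
    intro x hx y hy a b ha hb hab
    exact lt_of_lt_of_le (mul_pos (rpow_pos_of_pos hx _) (rpow_pos_of_pos hy _))
      (hpos x hx y hy a b ha hb hab)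
  have hconc : ConcaveOn ℝ S (fun x => Real.log (f x)) := by
    refine ⟨hSc, ?_⟩
    intro x hx y hy a b ha hb hab
    have hx' : 0 < f x := hx
    have hy' : 0 < f y := hy
    have := Real.log_le_log (mul_pos (rpow_pos_of_pos hx' _) (rpow_pos_of_pos hy' _))
      (hpos x hx y hy a b ha hb hab)
    rw [Real.log_mul (rpow_pos_of_pos hx' _).ne' (rpow_pos_of_pos hy' _).ne',
      Real.log_rpow hx', Real.log_rpow hy'] at this
    simpa using this
  have hcont : ContinuousOn f (interior S) := by
    have h2 := hconc.continuousOn_interior.rexp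
    refine h2.congr ?_
    intro x hx
    have hxS : x ∈ S := interior_subset hx
    have : 0 < f x := hxS
    simp [Real.exp_log this]
  classical
  refine ⟨(interior S).indicator f, ⟨?_, ?_⟩, ?_, ?_⟩
  · intro x
    exact Set.indicator_nonneg (fun x _ => h0 x) x
  · intro x y t ht0 ht1
    by_cases hx : x ∈ interior S
    · by_cases hy : y ∈ interior S
      · have hz : t • x + (1 - t) • y ∈ interior S :=
          hSc.interior hx hy ht0 (by linarith) (by ring)
        simp only [Set.indicator_of_mem, hx, hy, hz]
        exact h1 x y t ht0 ht1
      · rcases eq_or_lt_of_le ht1 with rfl | ht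
        · simp
        · rw [Set.indicator_of_notMem hy, Real.zero_rpow (by linarith), mul_zero]
          exact Set.indicator_nonneg (fun x _ => h0 x) _
    · rcases eq_or_lt_of_le ht0 with rfl | ht
      · simp
      · rw [Set.indicator_of_notMem hx, Real.zero_rpow (by linarith), zero_mul]
        exact Set.indicator_nonneg (fun x _ => h0 x) _
  · exact hcont.measurable_piecewise (g := 0) continuousOn_const isOpen_interior.measurableSet
  · have h3 := hSc.addHaar_frontier volume
    have : ∀ᵐ x ∂(volume : Measure (EuclideanSpace ℝ (Fin n))), x ∉ frontier S :=
      measure_eq_zero_iff_ae_notMem.1 h3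
    filter_upwards [this] with x hx
    by_cases hxi : x ∈ interior S
    · simp [hxi]
    · rw [Set.indicator_of_notMem hxi]
      by_contra hne
      have hxS : x ∈ S := lt_of_le_of_ne (h0 x) (Ne.symm hne)
      exact hx ⟨subset_closure hxS, hxi⟩

/-- The integral of a power of the density. -/
noncomputable def powInt {n : ℕ} (g : EuclideanSpace ℝ (Fin n) → ℝ) (α : ℝ) : ENNReal :=
  ∫⁻ x, ENNReal.ofReal (g x ^ α)

theorem powInt_scale {n : ℕ} {g : EuclideanSpace ℝ (Fin n) → ℝ} (hg : Measurable g)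
    {α : ℝ} (hα : 0 < α) :
    ∫⁻ x, ENNReal.ofReal (g (α⁻¹ • x) ^ α) = ENNReal.ofReal (α ^ n) * powInt g α := by
  have h := Measure.map_addHaar_smul (volume : Measure (EuclideanSpace ℝ (Fin n)))
    (inv_ne_zero hα.ne')
  have h2 := lintegral_map (μ := (volume : Measure (EuclideanSpace ℝ (Fin n))))
    (f := fun x => ENNReal.ofReal (g x ^ α)) (g := fun x => α⁻¹ • x) (by fun_prop) (by fun_prop)
  rw [← h2, h, lintegral_smul_measure, powInt]
  simp [abs_of_pos hα]

theorem powInt_logConcave {n : ℕ} {g : EuclideanSpace ℝ (Fin n) → ℝ} (hg : Measurable g)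
    (hlc : IsLogConcave g) {α β a b : ℝ} (hα : 0 < α) (hβ : 0 < β) (ha : 0 < a) (hb : 0 < b)
    (hab : a + b = 1) :
    (ENNReal.ofReal (α ^ n) * powInt g α) ^ a * (ENNReal.ofReal (β ^ n) * powInt g β) ^ b ≤
      ENNReal.ofReal ((a * α + b * β) ^ n) * powInt g (a * α + b * β) := by
  have hγ : 0 < a * α + b * β := by positivity
  rw [← powInt_scale hg hα, ← powInt_scale hg hβ, ← powInt_scale hg hγ]
  refine PLProp.euclidean n a b ha hb hab _ _ _ (by fun_prop) (by fun_prop) (by fun_prop) ?_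
  intro x y
  obtain ⟨h0, h1⟩ := hlc
  have hu := h0 (α⁻¹ • x)
  have hv := h0 (β⁻¹ • y)
  have key := h1 (α⁻¹ • x) (β⁻¹ • y) (a * α / (a * α + b * β)) (by positivity)
    (by rw [div_le_one hγ]; nlinarith [mul_pos hb hβ])
  have e1 : 1 - a * α / (a * α + b * β) = b * β / (a * α + b * β) := by field_simp; ring
  have e2 : (a * α / (a * α + b * β)) • α⁻¹ • x + (b * β / (a * α + b * β)) • β⁻¹ • y =
      (a * α + b * β)⁻¹ • (a • x + b • y) := by
    simp only [smul_smul, smul_add]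
    congr 2 <;> field_simp
  rw [e1, e2] at key
  set u := g (α⁻¹ • x)
  set v := g (β⁻¹ • y)
  have k2 := Real.rpow_le_rpow (by positivity) key hγ.le
  rw [Real.mul_rpow (by positivity) (by positivity), ← Real.rpow_mul hu, ← Real.rpow_mul hv,
    div_mul_cancel₀ _ hγ.ne', div_mul_cancel₀ _ hγ.ne'] at k2
  rw [ENNReal.ofReal_rpow_of_nonneg (by positivity) ha.le,
    ENNReal.ofReal_rpow_of_nonneg (by positivity) hb.le, ← Real.rpow_mul hu, ← Real.rpow_mul hv,
    ← ENNReal.ofReal_mul (by positivity), mul_comm α, mul_comm β]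
  exact ENNReal.ofReal_le_ofReal k2

theorem powInt_ne_zero {n : ℕ} {g : EuclideanSpace ℝ (Fin n) → ℝ} (hg : Measurable g)
    (h0 : ∀ x, 0 ≤ g x) (h1 : powInt g 1 = 1) {α : ℝ} (hα : 0 < α) : powInt g α ≠ 0 := by
  intro h
  rw [powInt, lintegral_eq_zero_iff (by fun_prop)] at h
  have : powInt g 1 = 0 := by
    rw [powInt, lintegral_eq_zero_iff (by fun_prop)]
    filter_upwards [h] with x hx
    simp only [Pi.zero_apply, ENNReal.ofReal_eq_zero, Real.rpow_one] at hx ⊢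
    by_contra hc
    exact absurd hx (not_le.2 (rpow_pos_of_pos (not_le.1 hc) _))
  rw [h1] at this
  exact one_ne_zero this

theorem powInt_ne_top {n : ℕ} {g : EuclideanSpace ℝ (Fin n) → ℝ} (hg : Measurable g)
    (hlc : IsLogConcave g) (h1 : powInt g 1 = 1) {α : ℝ} (hα : 0 < α) (hα2 : α < 2) :
    powInt g α ≠ ⊤ := by
  intro h
  have hβ : 0 < 2 - α := by linarith
  have key := powInt_logConcave hg hlc hα hβ (a := 1/2) (b := 1/2) (by norm_num) (by norm_num)
    (by norm_num)
  have e : 1 / 2 * α + 1 / 2 * (2 - α) = 1 := by ring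
  rw [e, h1, h, ENNReal.mul_top (by simp; positivity), ENNReal.top_rpow_of_pos (by norm_num),
    ENNReal.top_mul] at key
  · simp at key
  · have h3 := powInt_ne_zero hg hlc.1 h1 hβ
    have h4 : ENNReal.ofReal ((2 - α) ^ n) ≠ 0 := by simp; positivity
    have h5 := mul_ne_zero h4 h3
    rw [Ne, ENNReal.rpow_eq_zero_iff]
    rintro (h | h)
    · exact h5 h.1
    · norm_num at h

theorem lintegral_exp {n : ℕ} {g : EuclideanSpace ℝ (Fin n) → ℝ} (hg : Measurable g)
    (h0 : ∀ x, 0 ≤ g x) {s : ℝ} (hs : -1 < s) :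
    ∫⁻ x, ENNReal.ofReal (Real.exp (s * Real.log (g x)))
      ∂(volume.withDensity fun x => ENNReal.ofReal (g x)) = powInt g (1 + s) := by
  rw [lintegral_withDensity_eq_lintegral_mul _ (by fun_prop) (by fun_prop), powInt]
  refine lintegral_congr fun x => ?_
  simp only [Pi.mul_apply]
  rw [← ENNReal.ofReal_mul (h0 x)]
  congr 1
  rcases (h0 x).eq_or_lt with h | h
  · rw [← h, Real.zero_rpow (by linarith), zero_mul]
  · rw [Real.rpow_add h, Real.rpow_one, Real.rpow_def_of_pos h, mul_comm s]

theorem core {n : ℕ} (hn : 1 ≤ n) {g : EuclideanSpace ℝ (Fin n) → ℝ} (hg : Measurable g)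
    (hlc : IsLogConcave g)
    (hP : IsProbabilityMeasure (volume.withDensity fun x => ENNReal.ofReal (g x)))
    (ε : ℝ) (hε0 : 0 ≤ ε) (hε2 : ε ≤ 2) :
    (volume.withDensity fun x => ENNReal.ofReal (g x)).real
      {x | ε ≤ |(-Real.log (g x)) / n - hEnt g / n|} ≤ 4 * Real.exp (-(ε ^ 2) * n / 16) := by
  set ν : Measure (EuclideanSpace ℝ (Fin n)) := volume.withDensity fun x => ENNReal.ofReal (g x)
    with hν
  set Y : EuclideanSpace ℝ (Fin n) → ℝ := fun x => Real.log (g x) with hY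
  have hYm : Measurable Y := by fun_prop
  have h1 : powInt g 1 = 1 := by
    have := hP.measure_univ
    rw [hν, withDensity_apply _ MeasurableSet.univ, Measure.restrict_univ] at this
    simpa [powInt] using this
  have hexp : ∀ s : ℝ, -1 < s → ∫⁻ x, ENNReal.ofReal (Real.exp (s * Y x)) ∂ν = powInt g (1 + s) :=
    fun s hs => lintegral_exp hg hlc.1 hs
  have hInteg : ∀ s : ℝ, -1 < s → s < 1 → Integrable (fun x => Real.exp (s * Y x)) ν := by
    intro s hs hs1
    refine (lintegral_ofReal_ne_top_iff_integrable (by fun_prop) (by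
      exact Filter.Eventually.of_forall fun x => (Real.exp_pos _).le)).1 ?_
    rw [hexp s hs]
    exact powInt_ne_top hg hlc h1 (by linarith) (by linarith)
  have hmgf : ∀ s : ℝ, -1 < s → mgf Y ν s = (powInt g (1 + s)).toReal := by
    intro s hs
    rw [mgf, integral_eq_lintegral_of_nonneg_ae
      (Filter.Eventually.of_forall fun x => (Real.exp_pos _).le) (by fun_prop), hexp s hs]
  set φ : ℝ → ℝ := fun s => cgf Y ν s + n * Real.log (1 + s) with hφ
  have hφ' : ∀ s : ℝ, -1 < s → s < 1 →
      0 < (ENNReal.ofReal ((1 + s) ^ n) * powInt g (1 + s)).toReal ∧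
      φ s = Real.log (ENNReal.ofReal ((1 + s) ^ n) * powInt g (1 + s)).toReal := by
    intro s hs hs1
    have p1 : 0 < 1 + s := by linarith
    have p2 : 0 < (powInt g (1 + s)).toReal := ENNReal.toReal_pos
      (powInt_ne_zero hg hlc.1 h1 p1) (powInt_ne_top hg hlc h1 p1 (by linarith))
    rw [ENNReal.toReal_mul, ENNReal.toReal_ofReal (by positivity)]
    refine ⟨by positivity, ?_⟩
    rw [Real.log_mul (by positivity) p2.ne', Real.log_pow, hφ]
    simp only [cgf, hmgf s hs]
    ring
  have hconc : ConcaveOn ℝ (Set.Ioo (-1) 1) φ := by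
    refine concaveOn_iff_forall_pos.2 ⟨convex_Ioo _ _, ?_⟩
    intro s hs t ht a b ha hb hab
    have hst := convex_Ioo (-1 : ℝ) 1 hs ht ha.le hb.le hab
    obtain ⟨p1, q1⟩ := hφ' s hs.1 hs.2
    obtain ⟨p2, q2⟩ := hφ' t ht.1 ht.2
    obtain ⟨p3, q3⟩ := hφ' _ hst.1 hst.2
    have key := powInt_logConcave hg hlc (α := 1 + s) (β := 1 + t) (by linarith [hs.1])
      (by linarith [ht.1]) ha hb hab
    have e : a * (1 + s) + b * (1 + t) = 1 + (a • s + b • t) := by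
      simp only [smul_eq_mul]; linear_combination hab
    rw [e] at key
    have k2 := ENNReal.toReal_mono (fun h => by rw [h] at p3; simp at p3) key
    rw [ENNReal.toReal_mul, ← ENNReal.toReal_rpow, ← ENNReal.toReal_rpow] at k2
    have k3 := Real.log_le_log (mul_pos (rpow_pos_of_pos p1 _) (rpow_pos_of_pos p2 _)) k2
    rw [Real.log_mul (rpow_pos_of_pos p1 _).ne' (rpow_pos_of_pos p2 _).ne',
      Real.log_rpow p1, Real.log_rpow p2, ← q1, ← q2, ← q3] at k3
    simpa using k3
  have hsub : Set.Ioo (-1 : ℝ) 1 ⊆ integrableExpSet Y ν := fun s hs => hInteg s hs.1 hs.2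
  have h0mem : (0 : ℝ) ∈ interior (integrableExpSet Y ν) :=
    interior_mono hsub (by rw [isOpen_Ioo.interior_eq]; norm_num)
  set m := ∫ x, Y x ∂ν with hm
  have hder : HasDerivAt φ (m + n) 0 := by
    have d1 := (analyticAt_cgf h0mem).differentiableAt.hasDerivAt
    rw [deriv_cgf_zero h0mem] at d1
    have d2 : HasDerivAt (fun s : ℝ => (n : ℝ) * Real.log (1 + s)) n 0 := by
      have := (((hasDerivAt_id (0:ℝ)).const_add 1).log (by norm_num)).const_mul (n : ℝ)
      simpa using this
    rw [probReal_univ, div_one] at d1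
    exact d1.add d2
  have hφ0 : φ 0 = 0 := by simp [hφ]
  have htan : ∀ s : ℝ, -1 < s → s < 1 → cgf Y ν s ≤ (m + n) * s - n * Real.log (1 + s) := by
    intro s hs hs1
    suffices φ s ≤ (m + n) * s by simp only [hφ] at this; linarith
    rcases lt_trichotomy s 0 with h | h | h
    · have := hconc.le_slope_of_hasDerivAt ⟨hs, hs1⟩ (by norm_num) h hder
      rw [slope_def_field, hφ0, le_div_iff₀ (by linarith)] at this
      linarith
    · rw [h, hφ0]; simp
    · have := hconc.slope_le_of_hasDerivAt (by norm_num) ⟨hs, hs1⟩ h hder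
      rw [slope_def_field, hφ0, div_le_iff₀ (by linarith)] at this
      linarith
  have hent : hEnt g = -m := by
    rw [hEnt, hm, hν, integral_withDensity_eq_integral_toReal_smul (by fun_prop) (by simp)]
    simp [hY, ENNReal.toReal_ofReal (hlc.1 _)]
  have hn0 : (0 : ℝ) < n := by exact_mod_cast hn
  have hlog : ∀ s : ℝ, -(1/2) ≤ s → s - 2 * s ^ 2 ≤ Real.log (1 + s) := by
    intro s hs
    have p : 0 < 1 + s := by linarith
    refine le_trans ?_ (Real.one_sub_inv_le_log_of_pos p)
    have : 1 - (1 + s)⁻¹ = s / (1 + s) := by field_simp; ring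
    rw [this, le_div_iff₀ p]
    nlinarith [mul_nonneg (sq_nonneg s) (by linarith : 0 ≤ 1 + 2 * s)]
  have up : ν.real {x | m + n * ε ≤ Y x} ≤ Real.exp (-(ε ^ 2) * n / 16) := by
    refine (measure_ge_le_exp_cgf (t := ε / 4) _ (by linarith)
      (hInteg _ (by linarith) (by linarith))).trans ?_
    apply Real.exp_le_exp.2
    have t1 := htan (ε / 4) (by linarith) (by linarith)
    have t2 := mul_le_mul_of_nonneg_left (hlog (ε / 4) (by linarith)) hn0.le
    nlinarith [mul_nonneg hn0.le (sq_nonneg ε)]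
  have dn : ν.real {x | Y x ≤ m - n * ε} ≤ Real.exp (-(ε ^ 2) * n / 16) := by
    refine (measure_le_le_exp_cgf (t := -ε / 4) _ (by linarith)
      (hInteg _ (by linarith) (by linarith))).trans ?_
    apply Real.exp_le_exp.2
    have t1 := htan (-ε / 4) (by linarith) (by linarith)
    have t2 := mul_le_mul_of_nonneg_left (hlog (-ε / 4) (by linarith)) hn0.le
    nlinarith [mul_nonneg hn0.le (sq_nonneg ε)]
  have hsubset : {x | ε ≤ |(-Real.log (g x)) / n - hEnt g / n|} ⊆
      {x | m + n * ε ≤ Y x} ∪ {x | Y x ≤ m - n * ε} := by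
    intro x hx
    have hx' : ε ≤ |(-Real.log (g x)) / n - hEnt g / n| := hx
    rw [hent, ← sub_div, le_abs, le_div_iff₀ hn0, ← neg_div, le_div_iff₀ hn0] at hx'
    rcases hx' with h | h
    · right
      change Real.log (g x) ≤ _
      linarith
    · left
      change _ ≤ Real.log (g x)
      linarith
  have := (measureReal_mono hsubset (measure_ne_top ν _)).trans (measureReal_union_le _ _)
  linarith [Real.exp_pos (-(ε ^ 2) * n / 16)]

/-- Concentration of the information content of a log-concave random vector:
if `X` has a log-concave density `f` on ℝⁿ, then for `0 ≤ ε ≤ 2`,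
`P(|(-log f(X))/n - h(X)/n| ≥ ε) ≤ 4 exp(-ε² n / 16)`. -/
theorem information_content_concentration
    {n : ℕ} (hn : 1 ≤ n)
    {Ω : Type} [MeasureSpace Ω] (hP : IsProbabilityMeasure (ℙ : Measure Ω))
    (X : Ω → EuclideanSpace ℝ (Fin n)) (hX : Measurable X)
    (f : EuclideanSpace ℝ (Fin n) → ℝ) (hf : IsLogConcave f)
    (hXf : Measure.map X (ℙ : Measure Ω)
      = volume.withDensity (fun x => ENNReal.ofReal (f x)))
    (ε : ℝ) (hε0 : 0 ≤ ε) (hε2 : ε ≤ 2) :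
    ((ℙ : Measure Ω)
      {ω | ε ≤ |(-Real.log (f (X ω))) / n - hEnt f / n|}).toReal
      ≤ 4 * Real.exp (-(ε ^ 2) * n / 16) := by
  obtain ⟨g, hlc, hg, hfg⟩ := exists_measurable_version hf
  have hXg : Measure.map X (ℙ : Measure Ω)
      = volume.withDensity (fun x => ENNReal.ofReal (g x)) := by
    rw [hXf]
    apply withDensity_congr_ae
    filter_upwards [hfg] with x hx
    rw [hx]
  have hPg : IsProbabilityMeasure (volume.withDensity fun x => ENNReal.ofReal (g x)) := by
    rw [← hXg]
    exact Measure.isProbabilityMeasure_map hX.aemeasurable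
  have hent : hEnt f = hEnt g := by
    rw [hEnt, hEnt]
    congr 1
    apply integral_congr_ae
    filter_upwards [hfg] with x hx
    rw [hx]
  have hae : ∀ᵐ ω ∂(ℙ : Measure Ω), f (X ω) = g (X ω) := by
    have h1 : ∀ᵐ x ∂(Measure.map X (ℙ : Measure Ω)), f x = g x := by
      rw [hXf]
      exact (withDensity_absolutelyContinuous _ _).ae_le hfg
    exact ae_of_ae_map hX.aemeasurable h1
  have hmeas : MeasurableSet {x | ε ≤ |(-Real.log (g x)) / n - hEnt g / n|} :=
    measurableSet_le measurable_const (by fun_prop)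
  have hset : (ℙ : Measure Ω) {ω | ε ≤ |(-Real.log (f (X ω))) / n - hEnt f / n|} =
      (volume.withDensity fun x => ENNReal.ofReal (g x))
        {x | ε ≤ |(-Real.log (g x)) / n - hEnt g / n|} := by
    rw [← hXg, Measure.map_apply hX hmeas]
    apply measure_congr
    rw [Filter.eventuallyEq_set]
    filter_upwards [hae] with ω hω
    simp only [Set.mem_ofPred_eq, Set.mem_preimage, hω, hent]
  rw [hset]
  exact core hn hg hlc hPg ε hε0 hε2
end

section
/- There exists a universal constant c_M ∈ (0,1) with the following property: for every dimension n ≥ 1 and every probability measure μ on ℝⁿ with log-concave density f satisfying ‖f‖_∞ ≥ 1, there exists an ellipsoid ℰ ⊂ ℝⁿ of Lebesgue volume 1 such that μ(ℰ)^{1/n} ≥ c_M. Equivalently, there exists a linear volume-preserving map u : ℝⁿ → ℝⁿ such that (μ ∘ u^{−1})(D)^{1/n} ≥ c_M, where D is the Euclidean ball centered at the origin of volume one. -/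
open MeasureTheory ProbabilityTheory Real Pointwise

abbrev Eu (n : ℕ) := EuclideanSpace ℝ (Fin n)

noncomputable def eb (n : ℕ) : Module.Basis (Fin n) ℝ (Eu n) :=
  (EuclideanSpace.basisFun (Fin n) ℝ).toBasis

/-- matrix of a linear map in the standard basis -/
noncomputable def jm {n : ℕ} (A : Eu n →L[ℝ] Eu n) : Matrix (Fin n) (Fin n) ℝ :=
  LinearMap.toMatrix (eb n) (eb n) (A : Eu n →ₗ[ℝ] Eu n)

lemma jm_apply {n : ℕ} (A : Eu n →L[ℝ] Eu n) (i j : Fin n) :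
    jm A i j = (A (EuclideanSpace.single j 1)) i := by
  simp [jm, eb, LinearMap.toMatrix_apply]

lemma abs_coord_le {n : ℕ} (v : Eu n) (i : Fin n) : |v i| ≤ ‖v‖ := by
  have := PiLp.norm_apply_le v i
  simpa using this

lemma abs_jm_le {n : ℕ} (A : Eu n →L[ℝ] Eu n) (i j : Fin n) : |jm A i j| ≤ ‖A‖ := by
  rw [jm_apply]
  refine (abs_coord_le _ _).trans ?_
  simpa using A.le_opNorm (EuclideanSpace.single j (1:ℝ))

lemma det_jm {n : ℕ} (A : Eu n →L[ℝ] Eu n) : (jm A).det = A.det := by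
  simp [jm, LinearMap.det_toMatrix, ContinuousLinearMap.det]

/-- block map -/
noncomputable def blk {n : ℕ} (A B C D : Eu n →L[ℝ] Eu n) : (Eu n × Eu n) →L[ℝ] (Eu n × Eu n) :=
  (A.comp (ContinuousLinearMap.fst ℝ _ _) + B.comp (ContinuousLinearMap.snd ℝ _ _)).prod
  (C.comp (ContinuousLinearMap.fst ℝ _ _) + D.comp (ContinuousLinearMap.snd ℝ _ _))

lemma det_blk {n : ℕ} (A B C D : Eu n →L[ℝ] Eu n) :
    (blk A B C D).det = (Matrix.fromBlocks (jm A) (jm B) (jm C) (jm D)).det := by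
  rw [ContinuousLinearMap.det, ← LinearMap.det_toMatrix ((eb n).prod (eb n))]
  congr 1
  ext i j
  rcases i with i | i <;> rcases j with j | j <;>
    simp [LinearMap.toMatrix_apply, jm, blk]

lemma jm_add {n : ℕ} (A B : Eu n →L[ℝ] Eu n) : jm (A + B) = jm A + jm B := by
  ext i j; simp [jm_apply]
lemma jm_sub {n : ℕ} (A B : Eu n →L[ℝ] Eu n) : jm (A - B) = jm A - jm B := by
  ext i j; simp [jm_apply]
lemma jm_neg {n : ℕ} (A : Eu n →L[ℝ] Eu n) : jm (-A) = -jm A := by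
  ext i j; simp [jm_apply]
lemma jm_smul {n : ℕ} (c : ℝ) (A : Eu n →L[ℝ] Eu n) : jm (c • A) = c • jm A := by
  ext i j; simp [jm_apply]
lemma jm_one {n : ℕ} : jm (ContinuousLinearMap.id ℝ (Eu n)) = 1 := by
  simp [jm]

/-- complex block matrix of the deformed contour -/
noncomputable def Mz {n : ℕ} (A B : Matrix (Fin n) (Fin n) ℝ) (z : ℂ) :
    Matrix (Fin n ⊕ Fin n) (Fin n ⊕ Fin n) ℂ :=
  Matrix.fromBlocks (1 + A.map (algebraMap ℝ ℂ)) (z • (1 - B.map (algebraMap ℝ ℂ)))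
    (-(z • (1 - A.map (algebraMap ℝ ℂ)))) (1 + B.map (algebraMap ℝ ℂ))

lemma Mz_entry_le {n : ℕ} (A B : Matrix (Fin n) (Fin n) ℝ) (z : ℂ)
    (hA : ∀ i j, |A i j| ≤ 1) (hB : ∀ i j, |B i j| ≤ 1) (hz : ‖z‖ ≤ 1) (i j) :
    ‖Mz A B z i j‖ ≤ 2 := by
  have h1 : ∀ i j : Fin n, ‖(1 : Matrix (Fin n) (Fin n) ℂ) i j‖ ≤ 1 := by
    intro i j; rw [Matrix.one_apply]; split_ifs <;> simp
  have hA' : ∀ i j : Fin n, ‖((A i j : ℝ) : ℂ)‖ ≤ 1 := by intro i j; simpa using hA i j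
  have hB' : ∀ i j : Fin n, ‖((B i j : ℝ) : ℂ)‖ ≤ 1 := by intro i j; simpa using hB i j
  have hs : ∀ u v : ℂ, ‖u‖ ≤ 1 → ‖v‖ ≤ 1 → ‖z * (u - v)‖ ≤ 2 := by
    intro u v hu hv
    rw [norm_mul]
    have := norm_sub_le u v
    nlinarith [norm_nonneg z, norm_nonneg (u - v)]
  rcases i with i | i <;> rcases j with j | j
  · have := norm_add_le ((1 : Matrix (Fin n) (Fin n) ℂ) i j) ((A i j : ℝ) : ℂ)
    simp only [Mz, Matrix.fromBlocks_apply₁₁, Matrix.add_apply, Matrix.map_apply, Complex.coe_algebraMap]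
    linarith [h1 i j, hA' i j]
  · simpa [Mz] using hs _ _ (h1 i j) (hB' i j)
  · simpa [Mz] using hs _ _ (h1 i j) (hA' i j)
  · have := norm_add_le ((1 : Matrix (Fin n) (Fin n) ℂ) i j) ((B i j : ℝ) : ℂ)
    simp only [Mz, Matrix.fromBlocks_apply₂₂, Matrix.add_apply, Matrix.map_apply, Complex.coe_algebraMap]
    linarith [h1 i j, hB' i j]

noncomputable def dC (n : ℕ) : ℝ := ((n + n).factorial : ℝ) * 2 ^ (n + n)

lemma Mz_det_le {n : ℕ} (A B : Matrix (Fin n) (Fin n) ℝ) (z : ℂ)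
    (hA : ∀ i j, |A i j| ≤ 1) (hB : ∀ i j, |B i j| ≤ 1) (hz : ‖z‖ ≤ 1) :
    ‖(Mz A B z).det‖ ≤ dC n := by
  have := Matrix.det_le (A := Mz A B z) (abv := NormedField.toAbsoluteValue ℂ) (x := 2)
    (fun i j => Mz_entry_le A B z hA hB hz i j)
  simpa [dC, NormedField.toAbsoluteValue] using this

lemma Mz_real {n : ℕ} (A B : Eu n →L[ℝ] Eu n) (r : ℝ) :
    (Mz (jm A) (jm B) (r : ℂ)).det =
      ((blk (ContinuousLinearMap.id ℝ _ + A) (r • (ContinuousLinearMap.id ℝ _ - B))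
        (-(r • (ContinuousLinearMap.id ℝ _ - A))) (ContinuousLinearMap.id ℝ _ + B)).det : ℝ) := by
  rw [det_blk]
  have := RingHom.map_det (algebraMap ℝ ℂ) (Matrix.fromBlocks (jm (ContinuousLinearMap.id ℝ _ + A)) (jm (r • (ContinuousLinearMap.id ℝ _ - B)))
        (jm (-(r • (ContinuousLinearMap.id ℝ _ - A)))) (jm (ContinuousLinearMap.id ℝ _ + B)))
  rw [Complex.coe_algebraMap] at this
  rw [this]
  congr 1
  ext i j
  have h1 : ∀ i j : Fin n, (((1 : Matrix (Fin n) (Fin n) ℝ) i j : ℝ) : ℂ) = (1 : Matrix (Fin n) (Fin n) ℂ) i j := by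
    intro i j; rw [Matrix.one_apply, Matrix.one_apply]; split_ifs <;> simp
  rcases i with i | i <;> rcases j with j | j <;>
    simp [Mz, jm_add, jm_sub, jm_neg, jm_smul, jm_one, h1]

lemma Mz_I {n : ℕ} (A B : Matrix (Fin n) (Fin n) ℝ) :
    ‖(Mz A B Complex.I).det‖ = 2 ^ n * |(A + B).det| := by
  set a := A.map (algebraMap ℝ ℂ)
  set b := B.map (algebraMap ℝ ℂ)
  have key : (Matrix.fromBlocks 1 (Complex.I • 1) 1 (-(Complex.I • 1)) : Matrix (Fin n ⊕ Fin n) (Fin n ⊕ Fin n) ℂ)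
      * Mz A B Complex.I * (Matrix.fromBlocks 1 (-(Complex.I • 1)) 0 1) =
      Matrix.fromBlocks ((2:ℂ) • 1) 0 ((2:ℂ) • a) ((-(2:ℂ) * Complex.I) • (a + b)) := by
    simp only [Mz, Matrix.fromBlocks_multiply]
    have e : Complex.I * Complex.I = -1 := Complex.I_mul_I
    congr 1
    · simp [smul_smul, e]; 
      module
    · simp [smul_smul, e, mul_add, smul_sub]
    · simp [smul_smul, e]
      module
    · simp [smul_smul, e, mul_add, smul_sub, neg_mul]
      module
  have h1 := congrArg (fun M => ‖M.det‖) key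
  simp only [Matrix.det_mul, norm_mul] at h1
  rw [Matrix.det_fromBlocks_zero₁₂, Matrix.det_fromBlocks_zero₂₁, Matrix.det_fromBlocks_one₁₁] at h1
  have h2 : (-(Complex.I • (1 : Matrix (Fin n) (Fin n) ℂ)) - 1 * (Complex.I • 1)) = (-(2:ℂ) * Complex.I) • 1 := by
    simp; module
  have h3 : ((a + b).det) = (((A + B).det : ℝ) : ℂ) := by
    have := RingHom.map_det (algebraMap ℝ ℂ) (A + B)
    rw [Complex.coe_algebraMap] at this
    rw [this]; congr 1; ext i j; simp [a, b]
  rw [h2, Matrix.det_smul, Matrix.det_smul, Matrix.det_smul, h3] at h1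
  simp at h1
  exact h1

lemma Mz_diff {n : ℕ} (A B : Matrix (Fin n) (Fin n) ℝ) : Differentiable ℂ (fun z => (Mz A B z).det) := by
  simp only [Matrix.det_apply]
  apply Differentiable.fun_sum
  intro σ _
  apply Differentiable.const_smul
  apply Differentiable.fun_finsetProd
  intro i _
  rcases h1 : σ i with k | k <;> rcases h2 : i with j | j <;> simp [Mz]


lemma det_pos_of_near_id {V : Type*} [NormedAddCommGroup V] [NormedSpace ℝ V] [FiniteDimensional ℝ V]
    (L : V →L[ℝ] V) (h : ∀ v, v ≠ 0 → ‖L v - v‖ < ‖v‖) : 0 < L.det := by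
  by_contra hneg
  push Not at hneg
  let φ : ℝ → ℝ := fun t => (ContinuousLinearMap.id ℝ V + t • (L - ContinuousLinearMap.id ℝ V)).det
  have hc : Continuous φ := ContinuousLinearMap.continuous_det.comp (by fun_prop)
  have h0 : φ 0 = 1 := by simp [φ, ContinuousLinearMap.det]
  have h1 : φ 1 = L.det := by simp [φ]
  have := intermediate_value_Icc' (zero_le_one' ℝ) hc.continuousOn
  have h00 : (0:ℝ) ∈ Set.Icc (φ 1) (φ 0) := by rw [h0, h1]; exact ⟨hneg, zero_le_one⟩
  obtain ⟨t, ht, ht0⟩ := this h00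
  have hk := LinearMap.bot_lt_ker_of_det_eq_zero ht0
  obtain ⟨v, hv, hv0⟩ := (Submodule.ne_bot_iff _).1 hk.ne'
  rw [LinearMap.mem_ker] at hv
  have hv' : v = - (t • (L v - v)) := by
    have : v + t • (L v - v) = 0 := by simpa using hv
    exact eq_neg_of_add_eq_zero_left this
  have h2 : ‖v‖ = |t| * ‖L v - v‖ := by
    conv_lhs => rw [hv']
    rw [norm_neg, norm_smul, Real.norm_eq_abs]
  have h3 := h v hv0
  rw [abs_of_nonneg ht.1] at h2
  nlinarith [ht.2, norm_nonneg (L v - v), ht.1]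

section deform
variable {n : ℕ}

instance instHaarProd : (volume : Measure (Eu n × Eu n)).IsAddHaarMeasure := by
  rw [Measure.volume_eq_prod]; infer_instance

noncomputable def Pr (g : Eu n → Eu n) (r : ℝ) (p : Eu n × Eu n) : Eu n × Eu n :=
  (p.1 + r • p.2 + g p.1 - r • g p.2, p.2 - r • p.1 + g p.2 + r • g p.1)

noncomputable def PrD (g : Eu n → Eu n) (r : ℝ) (p : Eu n × Eu n) : (Eu n × Eu n) →L[ℝ] (Eu n × Eu n) :=
  blk (ContinuousLinearMap.id ℝ _ + fderiv ℝ g p.1) (r • (ContinuousLinearMap.id ℝ _ - fderiv ℝ g p.2))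
        (-(r • (ContinuousLinearMap.id ℝ _ - fderiv ℝ g p.1))) (ContinuousLinearMap.id ℝ _ + fderiv ℝ g p.2)

lemma Pr_hasFDerivAt (g : Eu n → Eu n) (hg : Differentiable ℝ g) (r : ℝ) (p : Eu n × Eu n) :
    HasFDerivAt (Pr g r) (PrD g r p) p := by
  have h1 : HasFDerivAt (fun p : Eu n × Eu n => g p.1) ((fderiv ℝ g p.1).comp (ContinuousLinearMap.fst ℝ _ _)) p :=
    HasFDerivAt.comp p (hg p.1).hasFDerivAt hasFDerivAt_fst
  have h2 : HasFDerivAt (fun p : Eu n × Eu n => g p.2) ((fderiv ℝ g p.2).comp (ContinuousLinearMap.snd ℝ _ _)) p :=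
    HasFDerivAt.comp p (hg p.2).hasFDerivAt hasFDerivAt_snd
  have f1 : HasFDerivAt (fun p : Eu n × Eu n => p.1) (ContinuousLinearMap.fst ℝ _ _) p := hasFDerivAt_fst
  have f2 : HasFDerivAt (fun p : Eu n × Eu n => p.2) (ContinuousLinearMap.snd ℝ _ _) p := hasFDerivAt_snd
  have := (((f1.add (f2.const_smul r)).add h1).sub (h2.const_smul r)).prodMk
    (((f2.sub (f1.const_smul r)).add h2).add (h1.const_smul r))
  refine this.congr_fderiv ?_
  ext v <;> simp [PrD, blk] <;> ring

lemma aux_norm (a gx ga : Eu n) (r m : ℝ) (hr : |r| ≤ 1/4) (ha : ‖a‖ ≤ m)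
    (hgx : ‖gx‖ ≤ m / 4) (hga : ‖ga‖ ≤ m / 4) : ‖r • a + gx - r • ga‖ ≤ 3/4 * m := by
  have h1 := norm_sub_le (r • a + gx) (r • ga)
  have h2 := norm_add_le (r • a) gx
  rw [norm_smul, Real.norm_eq_abs] at h1 h2
  nlinarith [norm_nonneg a, norm_nonneg ga, abs_nonneg r]

lemma Pr_approx (g : Eu n → Eu n) (hL : ∀ x y, ‖g x - g y‖ ≤ ‖x - y‖ / 4) (r : ℝ) (hr : |r| ≤ 1/4) :
    ApproximatesLinearOn (Pr g r) ((ContinuousLinearEquiv.refl ℝ (Eu n × Eu n)) : (Eu n × Eu n) →L[ℝ] (Eu n × Eu n))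
      Set.univ (3/4 : NNReal) := by
  intro p _ q _
  have hr' : |-r| ≤ 1/4 := by rwa [abs_neg]
  have n1 : ‖p.1 - q.1‖ ≤ ‖p - q‖ := norm_fst_le (p - q)
  have n2 : ‖p.2 - q.2‖ ≤ ‖p - q‖ := norm_snd_le (p - q)
  have e1 : (Pr g r p - Pr g r q - (p - q)).1 = r • (p.2 - q.2) + (g p.1 - g q.1) - r • (g p.2 - g q.2) := by
    simp [Pr]; module
  have e2 : (Pr g r p - Pr g r q - (p - q)).2 = (-r) • (p.1 - q.1) + (g p.2 - g q.2) - (-r) • (g p.1 - g q.1) := by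
    simp [Pr]; module
  have l1 := hL p.1 q.1
  have l2 := hL p.2 q.2
  change ‖Pr g r p - Pr g r q - (p - q)‖ ≤ _
  rw [Prod.norm_def, e1, e2]
  push_cast
  exact max_le (aux_norm _ _ _ _ _ hr n2 (by linarith) (by linarith))
    (aux_norm _ _ _ _ _ hr' n1 (by linarith) (by linarith))

lemma fderiv_bd (g : Eu n → Eu n) (hL : ∀ x y, ‖g x - g y‖ ≤ ‖x - y‖ / 4) (x : Eu n) :
    ‖fderiv ℝ g x‖ ≤ 1/4 := by
  have : LipschitzWith (1/4 : NNReal) g := by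
    apply LipschitzWith.of_dist_le_mul
    intro x y
    rw [dist_eq_norm, dist_eq_norm]
    have := hL x y
    push_cast
    linarith
  simpa using norm_fderiv_le_of_lipschitz ℝ (x₀ := x) this

lemma PrD_det_pos (g : Eu n → Eu n) (hL : ∀ x y, ‖g x - g y‖ ≤ ‖x - y‖ / 4) (r : ℝ) (hr : |r| ≤ 1/4)
    (p : Eu n × Eu n) : 0 < (PrD g r p).det := by
  apply det_pos_of_near_id
  intro v hv
  have hv' : 0 < ‖v‖ := norm_pos_iff.2 hv
  have hr' : |-r| ≤ 1/4 := by rwa [abs_neg]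
  have n1 : ‖v.1‖ ≤ ‖v‖ := norm_fst_le v
  have n2 : ‖v.2‖ ≤ ‖v‖ := norm_snd_le v
  have e1 : (PrD g r p v - v).1 = r • v.2 + (fderiv ℝ g p.1 v.1) - r • (fderiv ℝ g p.2 v.2) := by
    simp [PrD, blk]; module
  have e2 : (PrD g r p v - v).2 = (-r) • v.1 + (fderiv ℝ g p.2 v.2) - (-r) • (fderiv ℝ g p.1 v.1) := by
    simp [PrD, blk]; module
  have l1 := (fderiv ℝ g p.1).le_of_opNorm_le (fderiv_bd g hL _) v.1
  have l2 := (fderiv ℝ g p.2).le_of_opNorm_le (fderiv_bd g hL _) v.2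
  have : ‖PrD g r p v - v‖ ≤ 3/4 * ‖v‖ := by
    rw [Prod.norm_def, e1, e2]
    exact max_le (aux_norm _ _ _ _ _ hr n2 (by linarith) (by linarith))
      (aux_norm _ _ _ _ _ hr' n1 (by linarith) (by linarith))
  linarith

lemma Pr_bij (g : Eu n → Eu n) (hL : ∀ x y, ‖g x - g y‖ ≤ ‖x - y‖ / 4) (r : ℝ) (hr : |r| ≤ 1/4) :
    Function.Bijective (Pr g r) := by
  have h := Pr_approx g hL r hr
  have hc : Subsingleton (Eu n × Eu n) ∨ (3/4 : NNReal) <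
      ‖((ContinuousLinearEquiv.refl ℝ (Eu n × Eu n)).symm : (Eu n × Eu n) →L[ℝ] (Eu n × Eu n))‖₊⁻¹ := by
    rcases subsingleton_or_nontrivial (Eu n × Eu n) with hs | hs
    · exact Or.inl hs
    · right
      have : ‖((ContinuousLinearEquiv.refl ℝ (Eu n × Eu n)).symm : (Eu n × Eu n) →L[ℝ] (Eu n × Eu n))‖₊ = 1 := by
        simp
      rw [this, inv_one]
      rw [← NNReal.coe_lt_coe]; push_cast; norm_num
  refine ⟨?_, h.surjective hc⟩
  intro x y hxy
  have := h.injective hc (a₁ := ⟨x, trivial⟩) (a₂ := ⟨y, trivial⟩) hxy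
  exact congrArg Subtype.val this

noncomputable def s1 (g : Eu n → Eu n) (p : Eu n × Eu n) : ℝ :=
  ‖p.1‖^2 + ‖p.2‖^2 + ‖g p.1‖^2 + ‖g p.2‖^2
noncomputable def s2 (g : Eu n → Eu n) (p : Eu n × Eu n) : ℝ :=
  inner ℝ p.1 (g p.1) + inner ℝ p.2 (g p.2)
noncomputable def s3 (g : Eu n → Eu n) (p : Eu n × Eu n) : ℝ :=
  inner ℝ p.2 (g p.1) - inner ℝ p.1 (g p.2)

noncomputable def hz (g : Eu n → Eu n) (z : ℂ) (p : Eu n × Eu n) : ℂ :=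
  (1 + z^2) * s1 g p + 2 * (1 - z^2) * s2 g p + 4 * z * s3 g p

lemma hz_real (g : Eu n → Eu n) (r : ℝ) (p : Eu n × Eu n) :
    hz g r p = ((‖(Pr g r p).1‖^2 + ‖(Pr g r p).2‖^2 : ℝ) : ℂ) := by
  have : ‖(Pr g r p).1‖^2 + ‖(Pr g r p).2‖^2 = (1 + r^2) * s1 g p + 2 * (1 - r^2) * s2 g p + 4 * r * s3 g p := by
    simp only [Pr, s1, s2, s3, ← real_inner_self_eq_norm_sq, inner_add_left, inner_add_right, inner_sub_left,
      inner_sub_right, real_inner_smul_left, real_inner_smul_right]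
    rw [real_inner_comm p.1 p.2, real_inner_comm p.1 (g p.1), real_inner_comm p.1 (g p.2), real_inner_comm p.2 (g p.1),
      real_inner_comm p.2 (g p.2), real_inner_comm (g p.1) (g p.2)]
    ring
  rw [this, hz]; push_cast; ring

lemma gauss_prod (c : ℝ) (hc : 0 < c) :
    ∫ p : Eu n × Eu n, rexp (-c * (‖p.1‖^2 + ‖p.2‖^2)) = (π / c)^n := by
  have h := GaussianFourier.integral_rexp_neg_mul_sq_norm (V := Eu n) hc
  have h2 : ∀ p : Eu n × Eu n, rexp (-c * (‖p.1‖^2 + ‖p.2‖^2)) = rexp (-c * ‖p.1‖^2) * rexp (-c * ‖p.2‖^2) := by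
    intro p; rw [← Real.exp_add]; ring_nf
  simp_rw [h2]
  rw [Measure.volume_eq_prod, integral_prod_mul (fun x : Eu n => rexp (-c * ‖x‖^2)) (fun x : Eu n => rexp (-c * ‖x‖^2)), h, ← Real.rpow_add (by positivity)]
  simp

noncomputable def Psi (g : Eu n → Eu n) (c : ℝ) (z : ℂ) (p : Eu n × Eu n) : ℂ :=
  Complex.exp (-c * hz g z p) * (Mz (jm (fderiv ℝ g p.1)) (jm (fderiv ℝ g p.2)) z).det

lemma Psi_real (g : Eu n → Eu n) (hg : Differentiable ℝ g) (hL : ∀ x y, ‖g x - g y‖ ≤ ‖x - y‖ / 4)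
    (c : ℝ) (hc : 0 < c) (r : ℝ) (hr : |r| ≤ 1/4) :
    ∫ p, Psi g c r p = (((π / c)^n : ℝ) : ℂ) := by
  have hb := Pr_bij g hL r hr
  have h := integral_image_eq_integral_abs_det_fderiv_smul (volume : Measure (Eu n × Eu n)) MeasurableSet.univ
    (fun x _ => (Pr_hasFDerivAt g hg r x).hasFDerivWithinAt) hb.1.injOn
    (fun p => rexp (-c * (‖p.1‖^2 + ‖p.2‖^2)))
  rw [Set.image_univ, hb.2.range_eq, setIntegral_univ, setIntegral_univ, gauss_prod c hc] at h
  rw [h, ← integral_complex_ofReal]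
  congr 1
  ext p
  rw [Psi, hz_real, Mz_real, abs_of_pos (PrD_det_pos g hL r hr p)]
  change _ * ((PrD g r p).det : ℂ) = _
  push_cast
  rw [smul_eq_mul]
  push_cast
  ring
end deform


/-- holomorphic dependence of integrals -/
lemma diffOn_integral {α : Type*} [MeasurableSpace α] (μ : Measure α) (F : ℂ → α → ℂ) (U : Set ℂ) (hU : IsOpen U)
    (bound : α → ℝ) (hb : Integrable bound μ) (hm : ∀ z, AEStronglyMeasurable (F z) μ)
    (hd : ∀ a, Differentiable ℂ (fun z => F z a)) (hle : ∀ z ∈ U, ∀ a, ‖F z a‖ ≤ bound a) :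
    DifferentiableOn ℂ (fun z => ∫ a, F z a ∂μ) U := by
  intro z0 hz0
  obtain ⟨ε, hε, hball⟩ := Metric.isOpen_iff.1 hU z0 hz0
  have hsub : ∀ z ∈ Metric.ball z0 (ε/2), Metric.closedBall z (ε/4) ⊆ U := by
    intro z hz w hw
    apply hball
    rw [Metric.mem_ball] at *
    rw [Metric.mem_closedBall] at hw
    have := dist_triangle w z z0
    linarith
  have hF' : AEStronglyMeasurable (fun a => deriv (fun z => F z a) z0) μ := by
    let u : ℕ → ℂ := fun k => ((1 / ((k:ℝ) + 1) : ℝ) : ℂ)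
    have hu : Filter.Tendsto u Filter.atTop (nhdsWithin 0 {0}ᶜ) := by
      rw [tendsto_nhdsWithin_iff]
      constructor
      · have := tendsto_one_div_add_atTop_nhds_zero_nat (𝕜 := ℝ)
        have h2 := (Complex.continuous_ofReal.tendsto 0).comp this
        simpa [u, Function.comp_def] using h2
      · refine Filter.Eventually.of_forall fun k => ?_
        simp only [u, Set.mem_compl_iff, Set.mem_singleton_iff, Complex.ofReal_eq_zero]
        positivity
    refine aestronglyMeasurable_of_tendsto_ae (u := Filter.atTop) (f := fun k a => (u k)⁻¹ • (F (z0 + u k) a - F z0 a)) ?_ ?_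
    · intro k
      exact ((hm (z0 + u k)).sub (hm z0)).const_smul ((u k)⁻¹)
    · refine Filter.Eventually.of_forall fun a => ?_
      have := (hd a z0).hasDerivAt.tendsto_slope_zero
      exact this.comp hu
  have := hasDerivAt_integral_of_dominated_loc_of_deriv_le (μ := μ) (F := F) (x₀ := z0) (s := Metric.ball z0 (ε/2))
    (F' := fun z a => deriv (fun z => F z a) z) (bound := fun a => bound a / (ε/4))
    (Metric.ball_mem_nhds _ (by positivity)) (Filter.Eventually.of_forall hm)
    (hb.mono' (hm z0) (Filter.Eventually.of_forall (hle z0 hz0))) hF' ?_ (hb.div_const _) ?_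
  · exact this.2.differentiableAt.differentiableWithinAt
  · refine Filter.Eventually.of_forall fun a z hz => ?_
    apply Complex.norm_deriv_le_of_forall_mem_sphere_norm_le (by positivity) (hd a).diffContOnCl
    intro w hw
    exact hle w (hsub z hz (Metric.sphere_subset_closedBall hw)) a
  · refine Filter.Eventually.of_forall fun a z _ => (hd a z).hasDerivAt

section deform
variable {n : ℕ}

lemma re_hz_ge (g : Eu n → Eu n) (z : ℂ) (p : Eu n × Eu n) (δ : ℝ) (hδ : 0 < δ) (hδ1 : δ < 1/2)
    (hz1 : |z.re| < δ) (hz2 : |z.im| < 1 - 2 * δ) (hs2 : 0 ≤ s2 g p) :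
    (2 * δ - 3 * δ^2) * s1 g p ≤ (hz g z p).re := by
  have e : (hz g z p).re = (1 + z.re^2 - z.im^2) * s1 g p + 2 * (1 - z.re^2 + z.im^2) * s2 g p + 4 * z.re * s3 g p := by
    simp [hz, pow_two, Complex.add_re, Complex.mul_re]
    ring
  have hs1 : 0 ≤ s1 g p := by unfold s1; positivity
  have hs3 : |2 * s3 g p| ≤ s1 g p := by
    have a1 := norm_add_sq_real p.2 (g p.1)
    have a2 := norm_sub_sq_real p.2 (g p.1)
    have a3 := norm_add_sq_real p.1 (g p.2)
    have a4 := norm_sub_sq_real p.1 (g p.2)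
    rw [abs_le]
    unfold s3 s1
    constructor <;> nlinarith [sq_nonneg ‖p.2 + g p.1‖, sq_nonneg ‖p.2 - g p.1‖, sq_nonneg ‖p.1 + g p.2‖, sq_nonneg ‖p.1 - g p.2‖]
  have h4 : - (2 * |z.re| * s1 g p) ≤ 4 * z.re * s3 g p := by
    have : |4 * z.re * s3 g p| ≤ 2 * |z.re| * s1 g p := by
      have : 4 * z.re * s3 g p = 2 * z.re * (2 * s3 g p) := by ring
      rw [this, abs_mul, abs_mul, abs_two]
      exact mul_le_mul_of_nonneg_left hs3 (by positivity)
    exact (abs_le.1 this).1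
  have hr2 : z.re^2 = |z.re|^2 := (sq_abs _).symm
  have hi2 : z.im^2 = |z.im|^2 := (sq_abs _).symm
  have h5 : 0 ≤ 2 * (1 - z.re^2 + z.im^2) * s2 g p := by
    apply mul_nonneg _ hs2
    rw [hr2]
    nlinarith [abs_nonneg z.re, sq_nonneg z.im]
  have h6 : (2 * δ - 3 * δ^2) ≤ 1 + z.re^2 - z.im^2 - 2 * |z.re| := by
    rw [hr2, hi2]
    nlinarith [abs_nonneg z.re, abs_nonneg z.im]
  rw [e]
  nlinarith [mul_le_mul_of_nonneg_right h6 hs1]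

lemma hg_meas (g : Eu n → Eu n) (i j : Fin n) : Measurable (fun x => jm (fderiv ℝ g x) i j) := by
  simp_rw [jm_apply]
  have h1 := measurable_fderiv_apply_const ℝ g (EuclideanSpace.single j (1:ℝ))
  fun_prop

lemma Mz_det_meas (g : Eu n → Eu n) (z : ℂ) :
    Measurable (fun p : Eu n × Eu n => (Mz (jm (fderiv ℝ g p.1)) (jm (fderiv ℝ g p.2)) z).det) := by
  have m1 : ∀ i j, Measurable (fun p : Eu n × Eu n => ((jm (fderiv ℝ g p.1) i j : ℝ) : ℂ)) :=
    fun i j => Complex.measurable_ofReal.comp ((hg_meas g i j).comp measurable_fst)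
  have m2 : ∀ i j, Measurable (fun p : Eu n × Eu n => ((jm (fderiv ℝ g p.2) i j : ℝ) : ℂ)) :=
    fun i j => Complex.measurable_ofReal.comp ((hg_meas g i j).comp measurable_snd)
  simp only [Matrix.det_apply]
  apply Finset.measurable_fun_sum
  intro σ _
  apply Measurable.const_smul
  apply Finset.measurable_fun_prod
  intro i _
  rcases h1 : σ i with k | k <;> rcases h2 : i with j | j <;> simp only [Mz, Matrix.fromBlocks_apply₁₁, Matrix.fromBlocks_apply₁₂,
    Matrix.fromBlocks_apply₂₁, Matrix.fromBlocks_apply₂₂, Matrix.add_apply, Matrix.sub_apply, Matrix.smul_apply, Matrix.neg_apply,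
    Matrix.map_apply, Complex.coe_algebraMap] 
  · exact (m1 _ _).const_add _
  · exact ((m2 k j).const_sub _).const_smul z
  · exact (((m1 k j).const_sub _).const_smul z).fun_neg
  · exact (m2 _ _).const_add _

lemma s_cont (g : Eu n → Eu n) (hg : Continuous g) : Continuous (s1 g) ∧ Continuous (s2 g) ∧ Continuous (s3 g) := by
  unfold s1 s2 s3
  refine ⟨by fun_prop, by fun_prop, by fun_prop⟩

lemma Psi_meas (g : Eu n → Eu n) (hg : Differentiable ℝ g) (c : ℝ) (z : ℂ) :
    AEStronglyMeasurable (Psi g c z) := by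
  obtain ⟨h1, h2, h3⟩ := s_cont g hg.continuous
  apply Measurable.aestronglyMeasurable
  unfold Psi
  apply Measurable.mul _ (Mz_det_meas g z)
  apply Continuous.measurable
  unfold hz
  fun_prop

lemma Psi_diff (g : Eu n → Eu n) (c : ℝ) (p : Eu n × Eu n) : Differentiable ℂ (fun z => Psi g c z p) := by
  unfold Psi hz
  have := Mz_diff (jm (fderiv ℝ g p.1)) (jm (fderiv ℝ g p.2))
  fun_prop

lemma jm_fderiv_le (g : Eu n → Eu n) (hL : ∀ x y, ‖g x - g y‖ ≤ ‖x - y‖ / 4) (x : Eu n) (i j) :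
    |jm (fderiv ℝ g x) i j| ≤ 1 := by
  have := abs_jm_le (fderiv ℝ g x) i j
  linarith [fderiv_bd g hL x]

lemma gauss_prod_integrable (c : ℝ) (hc : 0 < c) :
    Integrable (fun p : Eu n × Eu n => rexp (-c * (‖p.1‖^2 + ‖p.2‖^2))) := by
  by_contra h
  have h1 := gauss_prod (n := n) c hc
  rw [integral_undef h] at h1
  have : 0 < (π / c)^n := by positivity
  linarith

def Uδ (δ : ℝ) : Set ℂ := {z | |z.re| < δ ∧ |z.im| < 1 - 2 * δ}

lemma Psi_bound (g : Eu n → Eu n) (hL : ∀ x y, ‖g x - g y‖ ≤ ‖x - y‖ / 4)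
    (h0 : ∀ x, 0 ≤ inner ℝ x (g x)) (c : ℝ) (hc : 0 < c) (δ : ℝ) (hδ : 0 < δ) (hδ1 : δ < 1/2)
    (z : ℂ) (hz' : z ∈ Uδ δ) (p : Eu n × Eu n) :
    ‖Psi g c z p‖ ≤ rexp (-(c * (2 * δ - 3 * δ^2)) * (‖p.1‖^2 + ‖p.2‖^2)) * dC n := by
  unfold Psi
  rw [norm_mul, Complex.norm_exp]
  have hn : ‖z‖ ≤ 1 := by
    have := Complex.norm_le_abs_re_add_abs_im z
    linarith [hz'.1, hz'.2]
  refine mul_le_mul ?_ (Mz_det_le _ _ _ (jm_fderiv_le g hL _) (jm_fderiv_le g hL _) hn) (norm_nonneg _) (Real.exp_pos _).le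
  rw [Real.exp_le_exp]
  have h1 := re_hz_ge g z p δ hδ hδ1 hz'.1 hz'.2 (add_nonneg (h0 _) (h0 _))
  have h2 : ‖p.1‖^2 + ‖p.2‖^2 ≤ s1 g p := by unfold s1; nlinarith [sq_nonneg ‖g p.1‖, sq_nonneg ‖g p.2‖]
  have h3 : (-(c:ℂ) * hz g z p).re = -(c * (hz g z p).re) := by
    simp
  rw [h3]
  have h4 : 0 < 2 * δ - 3 * δ^2 := by nlinarith
  have h5 : (2 * δ - 3 * δ^2) * (‖p.1‖^2 + ‖p.2‖^2) ≤ (hz g z p).re := (mul_le_mul_of_nonneg_left h2 h4.le).trans h1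
  nlinarith

lemma J_const (g : Eu n → Eu n) (hg : Differentiable ℝ g) (hL : ∀ x y, ‖g x - g y‖ ≤ ‖x - y‖ / 4)
    (h0 : ∀ x, 0 ≤ inner ℝ x (g x)) (c : ℝ) (hc : 0 < c) (δ : ℝ) (hδ : 0 < δ) (hδ1 : δ < 1/2)
    (z : ℂ) (hz' : z ∈ Uδ δ) : ∫ p, Psi g c z p = (((π / c)^n : ℝ) : ℂ) := by
  have hU : IsOpen (Uδ δ) := by
    exact (isOpen_lt (f := fun z : ℂ => |z.re|) (by fun_prop) continuous_const).inter
      (isOpen_lt (f := fun z : ℂ => |z.im|) (by fun_prop) continuous_const)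
  have hconv : Convex ℝ (Uδ δ) := by
    have e : Uδ δ = (Complex.reLm ⁻¹' Set.Ioo (-δ) δ) ∩ (Complex.imLm ⁻¹' Set.Ioo (-(1 - 2 * δ)) (1 - 2 * δ)) := by
      ext z; simp [Uδ, abs_lt]
    rw [e]
    exact ((convex_Ioo _ _).linear_preimage _).inter ((convex_Ioo _ _).linear_preimage _)
  have h4 : 0 < 2 * δ - 3 * δ^2 := by nlinarith
  have hd := diffOn_integral volume (Psi g c) (Uδ δ) hU _
    ((gauss_prod_integrable (c * (2 * δ - 3 * δ^2)) (by positivity)).mul_const (dC n)) (Psi_meas g hg c) (Psi_diff g c)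
    (fun z hz p => Psi_bound g hL h0 c hc δ hδ hδ1 z hz p)
  have h00 : (0:ℂ) ∈ Uδ δ := by simp [Uδ, hδ]; linarith
  refine (hd.analyticOnNhd hU).eqOn_of_preconnected_of_frequently_eq (g := fun _ => (((π / c)^n : ℝ) : ℂ)) analyticOnNhd_const
    hconv.isPreconnected h00 ?_ hz'
  let u : ℕ → ℂ := fun k => ((1 / ((k:ℝ) + 1) : ℝ) : ℂ)
  have hlim := tendsto_one_div_add_atTop_nhds_zero_nat (𝕜 := ℝ)
  have hu : Filter.Tendsto u Filter.atTop (nhdsWithin 0 {0}ᶜ) := by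
    rw [tendsto_nhdsWithin_iff]
    constructor
    · have h2 := (Complex.continuous_ofReal.tendsto 0).comp hlim
      simpa [u, Function.comp_def] using h2
    · refine Filter.Eventually.of_forall fun k => ?_
      simp only [u, Set.mem_compl_iff, Set.mem_singleton_iff, Complex.ofReal_eq_zero]
      positivity
  refine hu.frequently (Filter.Eventually.frequently ?_)
  have hev : ∀ᶠ k : ℕ in Filter.atTop, 1 / ((k:ℝ) + 1) < 1/4 := hlim.eventually_lt_const (by norm_num)
  filter_upwards [hev] with k hk
  exact Psi_real g hg hL c hc _ (by rw [abs_of_nonneg (by positivity)]; exact hk.le)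

/-- The main deformation inequality. -/
lemma deform_g (g : Eu n → Eu n) (hg : Differentiable ℝ g) (hL : ∀ x y, ‖g x - g y‖ ≤ ‖x - y‖ / 4)
    (h0 : ∀ x, 0 ≤ inner ℝ x (g x)) (c : ℝ) (hc : 0 < c)
    (hIntg : Integrable (fun x => rexp (-(2 * c) * inner ℝ x (g x)))) :
    (π / c)^n ≤ ∫ p : Eu n × Eu n, rexp (-(2 * c) * s2 g p) * (2 ^ n * |(fderiv ℝ g p.1 + fderiv ℝ g p.2).det|) := by
  have hIntg2 : Integrable (fun p : Eu n × Eu n => rexp (-(2 * c) * s2 g p) * dC n) := by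
    apply Integrable.mul_const
    have := Integrable.mul_prod hIntg hIntg
    refine this.congr (Filter.Eventually.of_forall fun p => ?_)
    simp only [s2]
    rw [← Real.exp_add]; ring_nf
  let u : ℕ → ℝ := fun k => 1 - 1 / ((k:ℝ) + 1)
  have hu : Filter.Tendsto u Filter.atTop (nhds 1) := by
    simpa [u] using (tendsto_one_div_add_atTop_nhds_zero_nat (𝕜 := ℝ)).const_sub 1
  have hu0 : ∀ k, 0 ≤ u k := by
    intro k
    have : 1 / ((k:ℝ) + 1) ≤ 1 := by
      rw [div_le_one (by positivity)]
      have : (0:ℝ) ≤ k := Nat.cast_nonneg k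
      linarith
    simp only [u]; linarith
  have hu1 : ∀ k, u k < 1 := by
    intro k
    have : 0 < 1 / ((k:ℝ) + 1) := by positivity
    simp only [u]; linarith
  have hzI : ∀ t : ℝ, 0 ≤ t → t < 1 → (((t:ℂ) * Complex.I)) ∈ Uδ ((1 - t)/4) := by
    intro t h0 h1
    simp only [Uδ, Set.mem_ofPred_eq, Complex.mul_re, Complex.mul_im, Complex.ofReal_re, Complex.I_re, Complex.ofReal_im, Complex.I_im]
    simp only [mul_zero, mul_one, sub_zero, add_zero, abs_zero, abs_of_nonneg h0]
    constructor <;> linarith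
  let f : ℕ → Eu n × Eu n → ℝ := fun k p => rexp (-(2 * c) * s2 g p) *
    ‖(Mz (jm (fderiv ℝ g p.1)) (jm (fderiv ℝ g p.2)) ((u k : ℂ) * Complex.I)).det‖
  have hnz : ∀ k, ‖((u k : ℂ) * Complex.I)‖ ≤ 1 := by
    intro k; rw [norm_mul, Complex.norm_I, mul_one, Complex.norm_real, Real.norm_eq_abs, abs_of_nonneg (hu0 k)]; exact (hu1 k).le
  have hfm : ∀ k, AEStronglyMeasurable (f k) := by
    intro k
    apply Measurable.aestronglyMeasurable
    refine Measurable.mul ?_ (Mz_det_meas g _).norm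
    have := (s_cont g hg.continuous).2.1
    exact Continuous.measurable (by fun_prop)
  have hfb : ∀ k p, ‖f k p‖ ≤ rexp (-(2 * c) * s2 g p) * dC n := by
    intro k p
    rw [Real.norm_eq_abs, abs_of_nonneg (by positivity)]
    exact mul_le_mul_of_nonneg_left (Mz_det_le _ _ _ (jm_fderiv_le g hL _) (jm_fderiv_le g hL _) (hnz k)) (Real.exp_pos _).le
  have hlow : ∀ k, (π / c)^n ≤ ∫ p, f k p := by
    intro k
    have h1 := J_const g hg hL h0 c hc ((1 - u k)/4) (by linarith [hu1 k]) (by linarith [hu0 k]) _ (hzI _ (hu0 k) (hu1 k))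
    have h2 : (π / c)^n = ‖∫ p, Psi g c ((u k : ℂ) * Complex.I) p‖ := by
      rw [h1, Complex.norm_real, Real.norm_eq_abs, abs_of_nonneg (by positivity)]
    rw [h2]
    refine norm_integral_le_of_norm_le (hIntg2.mono' (hfm k) (Filter.Eventually.of_forall (hfb k))) (Filter.Eventually.of_forall fun p => ?_)
    unfold Psi
    rw [norm_mul, Complex.norm_exp]
    refine mul_le_mul_of_nonneg_right ?_ (norm_nonneg _)
    rw [Real.exp_le_exp]
    have e : (-(c:ℂ) * hz g ((u k : ℂ) * Complex.I) p).re = -c * ((1 - u k^2) * s1 g p + 2 * (1 + u k^2) * s2 g p) := by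
      simp [hz, pow_two, Complex.add_re, Complex.mul_re]
      exact Or.inl (Or.inl (by ring))
    rw [e]
    have hs1 : 0 ≤ s1 g p := by unfold s1; positivity
    have hs2 : 0 ≤ s2 g p := add_nonneg (h0 _) (h0 _)
    have a1 : 0 ≤ (1 - u k^2) * s1 g p := mul_nonneg (by nlinarith [hu0 k, hu1 k]) hs1
    have a2 : 0 ≤ u k^2 * s2 g p := by positivity
    nlinarith [mul_nonneg hc.le a1, mul_nonneg hc.le a2]
  have hlim : Filter.Tendsto (fun k => ∫ p, f k p) Filter.atTop (nhds (∫ p : Eu n × Eu n, rexp (-(2 * c) * s2 g p) * (2 ^ n * |(fderiv ℝ g p.1 + fderiv ℝ g p.2).det|))) := by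
    refine tendsto_integral_of_dominated_convergence _ hfm hIntg2 (fun k => Filter.Eventually.of_forall (hfb k)) (Filter.Eventually.of_forall fun p => ?_)
    have e := Mz_I (jm (fderiv ℝ g p.1)) (jm (fderiv ℝ g p.2))
    rw [← jm_add, det_jm] at e
    rw [← e]
    apply Filter.Tendsto.const_mul
    have hcont := (Mz_diff (jm (fderiv ℝ g p.1)) (jm (fderiv ℝ g p.2))).continuous.norm
    have h1 : Filter.Tendsto (fun k => (u k : ℂ) * Complex.I) Filter.atTop (nhds Complex.I) := by
      have := ((Complex.continuous_ofReal.tendsto 1).comp hu).mul_const Complex.I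
      simpa [Function.comp_def] using this
    exact (hcont.tendsto Complex.I).comp h1
  exact ge_of_tendsto' hlim hlow
end deform


section B
variable {n : ℕ}

lemma det_smul_clm (c : ℝ) (A : Eu n →L[ℝ] Eu n) : (c • A).det = c ^ n * A.det := by
  rw [← det_jm, ← det_jm, jm_smul, Matrix.det_smul]; simp

lemma deform_G (G : Eu n → Eu n) (hG : Differentiable ℝ G) (c : ℝ) (hc : 0 < c)
    (hL : ∀ x y, ‖G x - G y‖ ≤ c * ‖x - y‖ / 4)
    (h0 : ∀ x, 0 ≤ inner ℝ x (G x))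
    (hIntg : Integrable (fun x => rexp (-2 * inner ℝ x (G x)))) :
    π^n ≤ 2 ^ n * ∫ p : Eu n × Eu n, rexp (-2 * s2 G p) * |(fderiv ℝ G p.1 + fderiv ℝ G p.2).det| := by
  let g : Eu n → Eu n := fun x => c⁻¹ • G x
  have hg : Differentiable ℝ g := hG.const_smul c⁻¹
  have hin : ∀ x y, inner ℝ x (g y) = c⁻¹ * inner ℝ x (G y) := fun x y => by simp [g, real_inner_smul_right]
  have hfd : ∀ x, fderiv ℝ g x = c⁻¹ • fderiv ℝ G x := fun x => fderiv_fun_const_smul (hG x) _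
  have h := deform_g g hg ?_ ?_ c hc ?_
  · have e : ∀ p : Eu n × Eu n, rexp (-(2 * c) * s2 g p) * (2 ^ n * |(fderiv ℝ g p.1 + fderiv ℝ g p.2).det|) =
        (c⁻¹ ^ n * 2 ^ n) * (rexp (-2 * s2 G p) * |(fderiv ℝ G p.1 + fderiv ℝ G p.2).det|) := by
      intro p
      have e1 : -(2 * c) * s2 g p = -2 * s2 G p := by
        simp only [s2, hin]; field_simp
      have e2 : c⁻¹ • fderiv ℝ G p.1 + c⁻¹ • fderiv ℝ G p.2 = c⁻¹ • (fderiv ℝ G p.1 + fderiv ℝ G p.2) := by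
        ext v; simp
      rw [e1, hfd, hfd, e2, det_smul_clm, abs_mul, abs_of_nonneg (by positivity : 0 ≤ c⁻¹ ^ n)]
      ring
    simp_rw [e] at h
    rw [integral_const_mul, div_eq_mul_inv, mul_pow, mul_comm, mul_assoc] at h
    exact le_of_mul_le_mul_left h (by positivity)
  · intro x y
    have : g x - g y = c⁻¹ • (G x - G y) := by simp [g, smul_sub]
    rw [this, norm_smul, Real.norm_eq_abs, abs_of_pos (by positivity), inv_mul_le_iff₀ hc]
    have := hL x y
    linarith
  · intro x; rw [hin]; exact mul_nonneg (by positivity) (h0 x)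
  · refine hIntg.congr (Filter.Eventually.of_forall fun x => ?_)
    simp only [hin]; congr 1; field_simp

noncomputable def Sm (G : Eu n → Eu n) (p : Eu n × Eu n) : Eu n × Eu n := (p.1 + p.2, G p.1 - G p.2)

lemma Sm_hasFDerivAt (g : Eu n → Eu n) (hg : Differentiable ℝ g) (p : Eu n × Eu n) :
    HasFDerivAt (Sm g) (blk (ContinuousLinearMap.id ℝ _) (ContinuousLinearMap.id ℝ _) (fderiv ℝ g p.1) (-(fderiv ℝ g p.2))) p := by
  have h1 : HasFDerivAt (fun p : Eu n × Eu n => g p.1) ((fderiv ℝ g p.1).comp (ContinuousLinearMap.fst ℝ _ _)) p :=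
    HasFDerivAt.comp p (hg p.1).hasFDerivAt hasFDerivAt_fst
  have h2 : HasFDerivAt (fun p : Eu n × Eu n => g p.2) ((fderiv ℝ g p.2).comp (ContinuousLinearMap.snd ℝ _ _)) p :=
    HasFDerivAt.comp p (hg p.2).hasFDerivAt hasFDerivAt_snd
  have f1 : HasFDerivAt (fun p : Eu n × Eu n => p.1) (ContinuousLinearMap.fst ℝ _ _) p := hasFDerivAt_fst
  have f2 : HasFDerivAt (fun p : Eu n × Eu n => p.2) (ContinuousLinearMap.snd ℝ _ _) p := hasFDerivAt_snd
  have := (f1.add f2).prodMk (h1.sub h2)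
  refine this.congr_fderiv ?_
  ext v <;> simp [blk]

lemma Sm_det (A B : Eu n →L[ℝ] Eu n) :
    |(blk (ContinuousLinearMap.id ℝ _) (ContinuousLinearMap.id ℝ _) A (-B)).det| = |(A + B).det| := by
  rw [det_blk, jm_one, Matrix.det_fromBlocks_one₁₁, mul_one, jm_neg]
  have : -jm B - jm A = -(jm (A + B)) := by rw [jm_add]; abel
  rw [this, Matrix.det_neg, abs_mul, det_jm]; simp

lemma Sm_inj (G : Eu n → Eu n) (hmon : ∀ x y, x ≠ y → 0 < inner ℝ (x - y) (G x - G y)) :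
    Function.Injective (Sm G) := by
  rintro ⟨x, a⟩ ⟨x', a'⟩ h
  simp only [Sm, Prod.mk.injEq] at h
  obtain ⟨h1, h2⟩ := h
  have e1 : x - x' = -(a - a') := by
    have : x - x' = (x + a) - (x' + a') - (a - a') := by abel
    rw [this, h1]; simp
  have e2 : G x - G x' = G a - G a' := by
    have : G x - G x' = (G x - G a) - (G x' - G a') + (G a - G a') := by abel
    rw [this, h2]; simp
  have hx : x = x' := by
    by_contra hne
    have h3 := hmon x x' hne
    rw [e1, e2, inner_neg_left] at h3
    have hne' : a ≠ a' := by
      rintro rfl; apply hne; simpa [sub_eq_zero] using e1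
    linarith [hmon a a' hne']
  subst hx
  simpa using h1

lemma upper_G (G : Eu n → Eu n) (hG : Differentiable ℝ G) (c : ℝ) (hc : 0 < c)
    (hL : ∀ x y, ‖G x - G y‖ ≤ c * ‖x - y‖ / 4)
    (h0 : ∀ x, 0 ≤ inner ℝ x (G x))
    (hIntg : Integrable (fun x => rexp (-2 * inner ℝ x (G x))))
    (hmon : ∀ x y, x ≠ y → 0 < inner ℝ (x - y) (G x - G y))
    (F : Eu n → ℝ) (hFc : Continuous F) (hF : ∀ x, F x ≤ inner ℝ x (G x))
    (hFconv : ∀ x a, 2 * F ((1/2:ℝ) • (x + a)) ≤ F x + F a)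
    (D : Set (Eu n)) (hD : MeasurableSet D) (hGD : ∀ x a, G x - G a ∈ D) :
    ENNReal.ofReal (π^n) ≤ 2 ^ n * ((∫⁻ s, ENNReal.ofReal (rexp (-4 * F ((1/2:ℝ) • s)))) * volume D) := by
  have h := deform_G G hG c hc hL h0 hIntg
  set I : ℝ := ∫ p : Eu n × Eu n, rexp (-2 * s2 G p) * |(fderiv ℝ G p.1 + fderiv ℝ G p.2).det| with hI
  have hI2 : ENNReal.ofReal I ≤ (∫⁻ s, ENNReal.ofReal (rexp (-4 * F ((1/2:ℝ) • s)))) * volume D := by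
    have a1 : ENNReal.ofReal I ≤ ∫⁻ p : Eu n × Eu n, ‖rexp (-2 * s2 G p) * |(fderiv ℝ G p.1 + fderiv ℝ G p.2).det|‖ₑ := by
      refine le_trans ?_ (enorm_integral_le_lintegral_enorm _)
      exact Real.ofReal_le_enorm _
    refine a1.trans ?_
    let Θ : Eu n × Eu n → ENNReal := fun q => ENNReal.ofReal (rexp (-4 * F ((1/2:ℝ) • q.1))) * D.indicator 1 q.2
    have hcv := lintegral_image_eq_lintegral_abs_det_fderiv_mul (volume : Measure (Eu n × Eu n)) MeasurableSet.univ
      (fun x _ => (Sm_hasFDerivAt G hG x).hasFDerivWithinAt) (Sm_inj G hmon).injOn Θ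
    rw [setLIntegral_univ] at hcv
    have hprod : ∫⁻ q, Θ q = (∫⁻ s, ENNReal.ofReal (rexp (-4 * F ((1/2:ℝ) • s)))) * volume D := by
      rw [Measure.volume_eq_prod]
      rw [lintegral_prod_mul (μ := volume) (ν := volume) (f := fun s : Eu n => ENNReal.ofReal (rexp (-4 * F ((1/2:ℝ) • s)))) (g := D.indicator 1)]
      · rw [lintegral_indicator_one hD]
      · exact (Continuous.measurable (by fun_prop)).ennreal_ofReal.aemeasurable
      · exact (measurable_one.indicator hD).aemeasurable
    rw [← hprod]
    refine le_trans ?_ (setLIntegral_le_lintegral (Sm G '' Set.univ) Θ)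
    rw [hcv]
    apply lintegral_mono
    intro p
    simp only
    rw [Sm_det, enorm_mul, mul_comm]
    refine mul_le_mul' ?_ ?_
    · rw [Real.enorm_eq_ofReal_abs, abs_abs]
    · simp only [Θ, Sm]
      rw [Set.indicator_of_mem (hGD _ _), Pi.one_apply, mul_one, Real.enorm_eq_ofReal_abs, abs_of_pos (Real.exp_pos _)]
      apply ENNReal.ofReal_le_ofReal
      rw [Real.exp_le_exp]
      have b1 := hFconv p.1 p.2
      have b2 := hF p.1
      have b3 := hF p.2
      simp only [s2]
      linarith
  calc ENNReal.ofReal (π^n) ≤ ENNReal.ofReal (2 ^ n * I) := ENNReal.ofReal_le_ofReal h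
    _ = 2 ^ n * ENNReal.ofReal I := by
      rw [ENNReal.ofReal_mul (by positivity), ENNReal.ofReal_pow (by norm_num)]; simp
    _ ≤ _ := by gcongr
end B


section C1
variable {n : ℕ}

noncomputable def Zf (K : Set (Eu n)) (y : Eu n) : ℝ := ∫ x in K, rexp (inner ℝ x y)
noncomputable def Vf (K : Set (Eu n)) (y : Eu n) : Eu n := ∫ x in K, rexp (inner ℝ x y) • x
noncomputable def Gf (K : Set (Eu n)) (y : Eu n) : Eu n := (Zf K y)⁻¹ • Vf K y
noncomputable def Ff (K : Set (Eu n)) (y : Eu n) : ℝ := Real.log (Zf K y / (volume K).toReal)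
noncomputable def Af (K : Set (Eu n)) (y : Eu n) : Eu n →L[ℝ] Eu n :=
  ∫ x in K, rexp (inner ℝ x y) • (innerSL ℝ x).smulRight x
noncomputable def Hf (K : Set (Eu n)) (y : Eu n) : Eu n →L[ℝ] Eu n :=
  (Zf K y)⁻¹ • Af K y - (innerSL ℝ (Gf K y)).smulRight (Gf K y)

variable {K : Set (Eu n)}

lemma intK (hK : IsCompact K) {E : Type*} [NormedAddCommGroup E] {φ : Eu n → E} (hφ : Continuous φ) :
    IntegrableOn φ K := hφ.continuousOn.integrableOn_compact hK

lemma hyper_null (v : Eu n) (hv : v ≠ 0) (a : ℝ) : volume {x : Eu n | inner ℝ x v = a} = 0 := by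
  by_cases h : ∃ x0 : Eu n, inner ℝ x0 v = a
  · obtain ⟨x0, hx0⟩ := h
    have : {x : Eu n | inner ℝ x v = a} = (fun x => x + -x0) ⁻¹' ((LinearMap.ker (innerSL ℝ v).toLinearMap : Submodule ℝ (Eu n)) : Set (Eu n)) := by
      ext x
      simp [← sub_eq_add_neg, ← hx0, real_inner_comm v]
      rw [inner_sub_right, sub_eq_zero]
    rw [this]
    rw [measure_preimage_add_right]
    apply Measure.addHaar_submodule
    intro h
    have : v ∈ LinearMap.ker (innerSL ℝ v).toLinearMap := by rw [h]; trivial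
    simp at this
    exact hv this
  · push Not at h
    convert measure_empty (μ := (volume : Measure (Eu n)))
    ext x; simp [h x]

lemma pos_int (hK : IsCompact K) (h0 : volume K ≠ 0) {φ : Eu n → ℝ} (hφ : Continuous φ) (hp : ∀ x, 0 ≤ φ x)
    (v : Eu n) (hv : v ≠ 0) (a : ℝ) (h : ∀ x, inner ℝ x v ≠ a → 0 < φ x) : 0 < ∫ x in K, φ x := by
  rw [setIntegral_pos_iff_support_of_nonneg_ae (Filter.Eventually.of_forall hp) (intK hK hφ)]
  have : K \ {x : Eu n | inner ℝ x v = a} ⊆ Function.support φ ∩ K := fun x hx => ⟨(h x hx.2).ne', hx.1⟩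
  refine lt_of_lt_of_le ?_ (measure_mono this)
  rw [measure_sdiff_null (hyper_null v hv a)]
  exact pos_iff_ne_zero.2 h0

lemma cexp (y : Eu n) : Continuous (fun x : Eu n => rexp (inner ℝ x y)) := by fun_prop

lemma Zf_pos (hK : IsCompact K) (h0 : volume K ≠ 0) (y : Eu n) : 0 < Zf K y := by
  unfold Zf
  rw [setIntegral_pos_iff_support_of_nonneg_ae (Filter.Eventually.of_forall fun x => (Real.exp_pos _).le) (intK hK (cexp y))]
  have : Function.support (fun x : Eu n => rexp (inner ℝ x y)) = Set.univ := by
    ext x; simp [(Real.exp_pos _).ne']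
  rw [this, Set.univ_inter]
  exact pos_iff_ne_zero.2 h0

lemma volK_pos (hK : IsCompact K) (h0 : volume K ≠ 0) : 0 < (volume K).toReal :=
  ENNReal.toReal_pos h0 hK.measure_lt_top.ne

lemma Vf_eq (hK : IsCompact K) (h0 : volume K ≠ 0) (y : Eu n) : Vf K y = Zf K y • Gf K y := by
  unfold Gf; rw [smul_smul, mul_inv_cancel₀ (Zf_pos hK h0 y).ne', one_smul]

lemma int_inner (hK : IsCompact K) (h0 : volume K ≠ 0) (y v : Eu n) :
    ∫ x in K, rexp (inner ℝ x y) * inner ℝ x v = Zf K y * inner ℝ (Gf K y) v := by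
  rw [← real_inner_smul_left, ← Vf_eq hK h0, Vf, real_inner_comm, ← integral_inner]
  · simp [real_inner_smul_right, real_inner_comm v]
  · exact intK hK (by fun_prop)

lemma tangent_Z (hK : IsCompact K) (h0 : volume K ≠ 0) (y w : Eu n) (hyw : w ≠ y) :
    Zf K y * rexp (inner ℝ (Gf K y) (w - y)) < Zf K w := by
  set m : ℝ := inner ℝ (Gf K y) (w - y) with hm
  let φ : Eu n → ℝ := fun x => rexp (inner ℝ x w) - (rexp m * (1 - m) * rexp (inner ℝ x y) + rexp m * (rexp (inner ℝ x y) * inner ℝ x (w - y)))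
  have hφ : ∀ x, φ x = rexp (inner ℝ x y) * rexp m * (rexp (inner ℝ x (w-y) - m) - ((inner ℝ x (w-y) - m) + 1)) := by
    intro x
    have : rexp (inner ℝ x w) = rexp (inner ℝ x y) * rexp m * rexp (inner ℝ x (w-y) - m) := by
      rw [← Real.exp_add, ← Real.exp_add, inner_sub_right]; congr 1; ring
    simp only [φ, this]; ring
  have := pos_int hK h0 (φ := φ) (by fun_prop) (fun x => by
    rw [hφ]; exact mul_nonneg (by positivity) (sub_nonneg.2 (Real.add_one_le_exp _))) (w - y) (sub_ne_zero.2 hyw) m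
    (fun x hx => by
      rw [hφ]; exact mul_pos (by positivity) (sub_pos.2 (Real.add_one_lt_exp (sub_ne_zero.2 hx))))
  simp only [φ] at this
  have i1 : IntegrableOn (fun x : Eu n => rexp (inner ℝ x w)) K := intK hK (by fun_prop)
  have i2 : IntegrableOn (fun x : Eu n => rexp m * (1 - m) * rexp (inner ℝ x y)) K := intK hK (by fun_prop)
  have i3 : IntegrableOn (fun x : Eu n => rexp m * (rexp (inner ℝ x y) * inner ℝ x (w - y))) K := intK hK (by fun_prop)
  have i4 : IntegrableOn (fun x : Eu n => rexp m * (1 - m) * rexp (inner ℝ x y) + rexp m * (rexp (inner ℝ x y) * inner ℝ x (w - y))) K := i2.add i3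
  rw [integral_sub i1 i4, integral_add i2 i3, integral_const_mul, integral_const_mul, int_inner hK h0, ← hm] at this
  simp only [Zf] at *
  linarith

lemma tangent_F (hK : IsCompact K) (h0 : volume K ≠ 0) (y w : Eu n) (hyw : w ≠ y) :
    Ff K y + inner ℝ (Gf K y) (w - y) < Ff K w := by
  have h := tangent_Z hK h0 y w hyw
  have hv := volK_pos hK h0
  have zy := Zf_pos hK h0 y
  have zw := Zf_pos hK h0 w
  unfold Ff
  rw [Real.log_div zy.ne' hv.ne', Real.log_div zw.ne' hv.ne']
  have := Real.log_lt_log (by positivity) h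
  rw [Real.log_mul zy.ne' (Real.exp_pos _).ne', Real.log_exp] at this
  linarith

lemma tangent_F_le (hK : IsCompact K) (h0 : volume K ≠ 0) (y w : Eu n) :
    Ff K y + inner ℝ (Gf K y) (w - y) ≤ Ff K w := by
  by_cases h : w = y
  · subst h; simp
  · exact (tangent_F hK h0 y w h).le

lemma Zf_zero : Zf K 0 = (volume K).toReal := by simp [Zf, Measure.real]

lemma Ff_zero (hK : IsCompact K) (h0 : volume K ≠ 0) : Ff K 0 = 0 := by
  rw [Ff, Zf_zero, div_self (volK_pos hK h0).ne', Real.log_one]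

lemma Gf_zero (hc : ∫ x in K, x = 0) : Gf K 0 = 0 := by
  simp [Gf, Vf, hc]

lemma Ff_pos (hK : IsCompact K) (h0 : volume K ≠ 0) (hc : ∫ x in K, x = 0) (y : Eu n) (hy : y ≠ 0) : 0 < Ff K y := by
  have := tangent_F hK h0 0 y hy
  rwa [Ff_zero hK h0, Gf_zero hc, inner_zero_left, zero_add] at this

lemma Ff_nonneg (hK : IsCompact K) (h0 : volume K ≠ 0) (hc : ∫ x in K, x = 0) (y : Eu n) : 0 ≤ Ff K y := by
  have := tangent_F_le hK h0 0 y
  rwa [Ff_zero hK h0, Gf_zero hc, inner_zero_left, zero_add] at this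

lemma Ff_le_inner (hK : IsCompact K) (h0 : volume K ≠ 0) (y : Eu n) : Ff K y ≤ inner ℝ y (Gf K y) := by
  have := tangent_F_le hK h0 y 0
  rw [Ff_zero hK h0, zero_sub, inner_neg_right, real_inner_comm] at this
  linarith

lemma Gf_mono (hK : IsCompact K) (h0 : volume K ≠ 0) (x y : Eu n) (hxy : x ≠ y) :
    0 < inner ℝ (x - y) (Gf K x - Gf K y) := by
  have h1 := tangent_F hK h0 x y hxy.symm
  have h2 := tangent_F hK h0 y x hxy
  rw [inner_sub_right, real_inner_comm (Gf K x), real_inner_comm (Gf K y)] 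
  have : inner ℝ (Gf K x) (y - x) = - inner ℝ (Gf K x) (x - y) := by rw [← inner_neg_right]; simp
  linarith

lemma Ff_convex (hK : IsCompact K) (h0 : volume K ≠ 0) (x y : Eu n) (a b : ℝ) (ha : 0 ≤ a) (hb : 0 ≤ b) (hab : a + b = 1) :
    Ff K (a • x + b • y) ≤ a * Ff K x + b * Ff K y := by
  set z := a • x + b • y with hz
  have h1 := tangent_F_le hK h0 z x
  have h2 := tangent_F_le hK h0 z y
  have h3 : a * inner ℝ (Gf K z) (x - z) + b * inner ℝ (Gf K z) (y - z) = 0 := by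
    rw [← real_inner_smul_right, ← real_inner_smul_right, ← inner_add_right]
    have : a • (x - z) + b • (y - z) = 0 := by
      rw [smul_sub, smul_sub]
      have : a • z + b • z = z := by rw [← add_smul, hab, one_smul]
      calc a • x - a • z + (b • y - b • z) = (a • x + b • y) - (a • z + b • z) := by abel
        _ = 0 := by rw [this, hz, sub_self]
    rw [this, inner_zero_right]
  have e : Ff K z = a * Ff K z + b * Ff K z := by rw [← add_mul, hab, one_mul]
  nlinarith [mul_le_mul_of_nonneg_left h1 ha, mul_le_mul_of_nonneg_left h2 hb]

lemma Gf_mem (hK : IsCompact K) (hcv : Convex ℝ K) (h0 : volume K ≠ 0) (y : Eu n) : Gf K y ∈ K := by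
  by_contra hG
  obtain ⟨f, u, h1, h2⟩ := geometric_hahn_banach_closed_point hcv hK.isClosed hG
  let v := (InnerProductSpace.toDual ℝ (Eu n)).symm f
  have hv : ∀ x, f x = inner ℝ x v := fun x => by
    rw [real_inner_comm]; exact (InnerProductSpace.toDual_symm_apply).symm
  have h3 := int_inner hK h0 y v
  have h4 : ∫ x in K, rexp (inner ℝ x y) * inner ℝ x v ≤ ∫ x in K, rexp (inner ℝ x y) * u := by
    apply setIntegral_mono_on (intK hK (by fun_prop)) (intK hK (by fun_prop)) hK.measurableSet
    intro x hx
    have := h1 x hx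
    rw [hv] at this
    gcongr
  rw [h3, integral_mul_const] at h4
  have := le_of_mul_le_mul_left h4 (Zf_pos hK h0 y)
  rw [hv] at h2
  linarith

end C1


section C2
variable {n : ℕ} {K : Set (Eu n)}

lemma intK' (hK : IsCompact K) {E : Type*} [NormedAddCommGroup E] {φ : Eu n → E} (hφ : Continuous φ) :
    Integrable φ (volume.restrict K) := hφ.continuousOn.integrableOn_compact hK

lemma hasFDerivAt_par (hK : IsCompact K) {E : Type*} [NormedAddCommGroup E] [NormedSpace ℝ E] 
    {ψ : Eu n → E} (hψ : Continuous ψ) (y : Eu n) :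
    HasFDerivAt (fun y => ∫ x in K, rexp (inner ℝ x y) • ψ x)
      (∫ x in K, rexp (inner ℝ x y) • (innerSL ℝ x).smulRight (ψ x)) y := by
  obtain ⟨R, hR⟩ := hK.isBounded.exists_norm_le
  obtain ⟨C, hC⟩ := hK.exists_bound_of_continuousOn hψ.continuousOn
  have hcl : Continuous fun x : Eu n => (innerSL ℝ x).smulRight (ψ x) := by
    have : (fun x : Eu n => (innerSL ℝ x).smulRight (ψ x)) = fun x => ContinuousLinearMap.smulRightL ℝ (Eu n) E (innerSL ℝ x) (ψ x) := by
      ext; simp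
    rw [this]; fun_prop
  refine hasFDerivAt_integral_of_dominated_of_fderiv_le (μ := volume.restrict K) (s := Metric.ball y 1)
    (F' := fun y x => rexp (inner ℝ x y) • (innerSL ℝ x).smulRight (ψ x)) (bound := fun _ => rexp (R * (‖y‖ + 1)) * (R * C)) 
    (Metric.ball_mem_nhds y one_pos) ?_ ?_ ?_ ?_ ?_ ?_
  · exact Filter.Eventually.of_forall fun z => (intK hK (by fun_prop)).aestronglyMeasurable
  · exact (intK hK (by fun_prop))
  · exact (intK hK (by fun_prop)).aestronglyMeasurable
  · filter_upwards [ae_restrict_mem hK.measurableSet] with x hx z hz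
    have r1 := hR x hx
    have c1 := hC x hx
    have hR0 : 0 ≤ R := (norm_nonneg _).trans r1
    rw [norm_smul, ContinuousLinearMap.norm_smulRight_apply, innerSL_apply_norm, Real.norm_eq_abs, abs_of_pos (Real.exp_pos _)]
    gcongr
    have h1 : inner ℝ x z ≤ ‖x‖ * ‖z‖ := real_inner_le_norm _ _
    have h2 : ‖z‖ ≤ ‖y‖ + 1 := by
      have := norm_le_norm_add_norm_sub' z y
      rw [Metric.mem_ball, dist_eq_norm] at hz
      linarith
    exact h1.trans (mul_le_mul r1 h2 (norm_nonneg _) hR0)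
  · exact (intK hK continuous_const)
  · refine Filter.Eventually.of_forall fun x z _ => ?_
    have h1 : HasFDerivAt (fun z : Eu n => (inner ℝ x z : ℝ)) (innerSL ℝ x) z := (innerSL ℝ x).hasFDerivAt
    have h2 := (h1.exp.smul_const (ψ x))
    convert h2 using 1
    ext v; simp [smul_smul]

lemma Zf_hasFDerivAt (hK : IsCompact K) (y : Eu n) : HasFDerivAt (Zf K) (innerSL ℝ (Vf K y)) y := by
  have h := hasFDerivAt_par hK (ψ := fun _ => (1:ℝ)) continuous_const y
  have e : (fun y => ∫ x in K, rexp (inner ℝ x y) • (1:ℝ)) = Zf K := by ext y; simp [Zf]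
  rw [e] at h
  refine h.congr_fderiv ?_
  ext v
  symm
  rw [ContinuousLinearMap.integral_apply (intK' hK (by
    have : (fun x : Eu n => rexp (inner ℝ x y) • (innerSL ℝ x).smulRight (1:ℝ)) = fun x => rexp (inner ℝ x y) • innerSL ℝ x := by
      ext; simp
    rw [this]; fun_prop))]
  simp only [ContinuousLinearMap.smul_apply, ContinuousLinearMap.smulRight_apply, innerSL_apply_apply]
  rw [Vf, real_inner_comm, ← integral_inner (intK hK (by fun_prop))]
  simp [real_inner_smul_right, real_inner_comm v]

lemma contA : Continuous fun x : Eu n => (innerSL ℝ x).smulRight x := by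
  have : (fun x : Eu n => (innerSL ℝ x).smulRight x) = fun x => ContinuousLinearMap.smulRightL ℝ (Eu n) (Eu n) (innerSL ℝ x) x := by
    ext; simp
  rw [this]; fun_prop

lemma Gf_hasFDerivAt (hK : IsCompact K) (h0 : volume K ≠ 0) (y : Eu n) : HasFDerivAt (Gf K) (Hf K y) y := by
  have h1 := Zf_hasFDerivAt hK y
  have h2 : HasFDerivAt (Vf K) (Af K y) y := hasFDerivAt_par hK continuous_id y
  have z := (Zf_pos hK h0 y).ne'
  have h3 := ((hasDerivAt_inv z).comp_hasFDerivAt y h1).fun_smul h2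
  have : Gf K = fun y => (Zf K y)⁻¹ • Vf K y := rfl
  rw [this]
  refine h3.congr_fderiv ?_
  unfold Hf
  rw [sub_eq_add_neg]
  congr 1
  rw [Vf_eq hK h0]
  ext v
  simp [real_inner_smul_left]
  field_simp

lemma inner_Hf (hK : IsCompact K) (h0 : volume K ≠ 0) (y v w : Eu n) :
    inner ℝ (Hf K y v) w = (Zf K y)⁻¹ * ∫ x in K, rexp (inner ℝ x y) * (inner ℝ (x - Gf K y) v * inner ℝ (x - Gf K y) w) := by
  have e1 : inner ℝ (Af K y v) w = ∫ x in K, rexp (inner ℝ x y) * (inner ℝ x v * inner ℝ x w) := by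
    have hc := contA (n := n)
    rw [Af, ContinuousLinearMap.integral_apply (intK' hK (by fun_prop)), real_inner_comm, ← integral_inner (intK hK (by simp; fun_prop))]
    simp [real_inner_smul_right, real_inner_comm w]
  have z := (Zf_pos hK h0 y).ne'
  have e2 : ∀ x : Eu n, rexp (inner ℝ x y) * (inner ℝ (x - Gf K y) v * inner ℝ (x - Gf K y) w) =
      (rexp (inner ℝ x y) * (inner ℝ x v * inner ℝ x w) - inner ℝ (Gf K y) w * (rexp (inner ℝ x y) * inner ℝ x v)) - 
      (inner ℝ (Gf K y) v * (rexp (inner ℝ x y) * inner ℝ x w) - inner ℝ (Gf K y) v * inner ℝ (Gf K y) w * rexp (inner ℝ x y)) := by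
    intro x; rw [inner_sub_left, inner_sub_left]; ring
  simp_rw [e2]
  rw [integral_sub (intK hK (by fun_prop)) (intK hK (by fun_prop)), integral_sub (intK hK (by fun_prop)) (intK hK (by fun_prop)),
    integral_sub (intK hK (by fun_prop)) (intK hK (by fun_prop)), integral_const_mul, integral_const_mul, integral_const_mul, ← e1,
    int_inner hK h0, int_inner hK h0]
  have : ∫ x in K, rexp (inner ℝ x y) = Zf K y := rfl
  rw [this, Hf]
  simp [inner_sub_left, real_inner_smul_left]
  field_simp
  ring

lemma Hf_norm_le (hK : IsCompact K) (hcv : Convex ℝ K) (h0 : volume K ≠ 0) {R : ℝ} (hR : ∀ x ∈ K, ‖x‖ ≤ R) (y : Eu n) :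
    ‖Hf K y‖ ≤ 2 * R ^ 2 := by
  have hz := Zf_pos hK h0 y
  have hA : ‖Af K y‖ ≤ Zf K y * R ^ 2 := by
    refine (norm_integral_le_integral_norm _).trans ?_
    rw [Zf, ← integral_mul_const]
    have hc := contA (n := n)
    apply setIntegral_mono_on (intK hK (by fun_prop)) (intK hK (by fun_prop)) hK.measurableSet
    intro x hx
    rw [norm_smul, ContinuousLinearMap.norm_smulRight_apply, innerSL_apply_norm, Real.norm_eq_abs, abs_of_pos (Real.exp_pos _), sq]
    have := hR x hx
    have hR0 : 0 ≤ R := (norm_nonneg _).trans this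
    gcongr
  have hg := hR _ (Gf_mem hK hcv h0 y)
  have hR0 : 0 ≤ R := (norm_nonneg _).trans hg
  refine (norm_sub_le _ _).trans ?_
  rw [norm_smul, ContinuousLinearMap.norm_smulRight_apply, innerSL_apply_norm, norm_inv, Real.norm_eq_abs, abs_of_pos hz]
  have h1 : (Zf K y)⁻¹ * ‖Af K y‖ ≤ R ^ 2 := by
    rw [inv_mul_le_iff₀ hz]; exact hA
  have h2 : ‖Gf K y‖ * ‖Gf K y‖ ≤ R ^ 2 := by rw [sq]; gcongr
  linarith

lemma Gf_lip (hK : IsCompact K) (hcv : Convex ℝ K) (h0 : volume K ≠ 0) {R : ℝ} (hR : ∀ x ∈ K, ‖x‖ ≤ R) (x y : Eu n) :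
    ‖Gf K x - Gf K y‖ ≤ 2 * R ^ 2 * ‖x - y‖ :=
  Convex.norm_image_sub_le_of_norm_hasFDerivWithin_le (s := Set.univ) (fun x _ => (Gf_hasFDerivAt hK h0 x).hasFDerivWithinAt)
    (fun x _ => Hf_norm_le hK hcv h0 hR x) convex_univ trivial trivial

lemma Zf_cont (hK : IsCompact K) : Continuous (Zf K) :=
  continuous_iff_continuousAt.2 fun y => (Zf_hasFDerivAt hK y).continuousAt

lemma Ff_cont (hK : IsCompact K) (h0 : volume K ≠ 0) : Continuous (Ff K) := by
  unfold Ff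
  refine Continuous.log ((Zf_cont hK).div_const _) fun y => ?_
  exact (div_pos (Zf_pos hK h0 y) (volK_pos hK h0)).ne'
end C2


section C3
variable {n : ℕ} {K : Set (Eu n)}

lemma integrable_exp_neg_norm (c : ℝ) (hc : 0 < c) : Integrable (fun y : Eu n => rexp (-(c * ‖y‖))) := by
  have h := integrable_one_add_norm (E := Eu n) (μ := volume) (r := (n+1 : ℝ)) (by simp)
  refine (h.const_mul (rexp c * (n+1).factorial / c ^ (n+1))).mono' (by fun_prop) (Filter.Eventually.of_forall fun y => ?_)
  rw [Real.norm_eq_abs, abs_of_pos (Real.exp_pos _)]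
  have h1 := Real.pow_div_factorial_le_exp (c * (1 + ‖y‖)) (by positivity) (n+1)
  have h2 : ((1:ℝ) + ‖y‖) ^ (-(n+1 : ℝ)) = ((1 + ‖y‖) ^ (n+1))⁻¹ := by
    rw [Real.rpow_neg (by positivity)]; norm_cast
  rw [h2, mul_pow, div_le_iff₀ (by positivity), mul_add, mul_one, Real.exp_add] at *
  rw [Real.exp_neg, ← div_eq_mul_inv, div_div, inv_le_iff_one_le_mul₀ (Real.exp_pos _), div_mul_eq_mul_div, le_div_iff₀ (by positivity)]
  linarith

lemma Ff_growth (hK : IsCompact K) (h0 : volume K ≠ 0) (hc : ∫ x in K, x = 0) :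
    ∃ m > 0, ∀ y, m * ‖y‖ - m ≤ Ff K y := by
  obtain ⟨m, hm, h⟩ := (isCompact_sphere (0 : Eu n) 1).exists_forall_le' (Ff_cont hK h0).continuousOn (a := 0) (fun b hb => 
    Ff_pos hK h0 hc b (by rintro rfl; simp at hb))
  refine ⟨m, hm, fun y => ?_⟩
  by_cases hy : ‖y‖ < 1
  · have := Ff_nonneg hK h0 hc y
    nlinarith
  · push Not at hy
    have hy0 : 0 < ‖y‖ := by linarith
    have h1 := h (‖y‖⁻¹ • y) (by simp [norm_smul, hy0.ne'])
    have h2 := Ff_convex hK h0 y 0 ‖y‖⁻¹ (1 - ‖y‖⁻¹) (by positivity) (sub_nonneg.2 (inv_le_one_of_one_le₀ hy)) (by ring)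
    rw [smul_zero, add_zero, Ff_zero hK h0, mul_zero, add_zero] at h2
    have h3 := h1.trans h2
    rw [inv_mul_eq_div, le_div_iff₀ hy0] at h3
    linarith

lemma integrable_exp_F (hK : IsCompact K) (h0 : volume K ≠ 0) (hc : ∫ x in K, x = 0) (a : ℝ) (ha : 0 < a) :
    Integrable (fun y => rexp (-a * Ff K y)) := by
  obtain ⟨m, hm, h⟩ := Ff_growth hK h0 hc
  have hF := Ff_cont hK h0
  refine ((integrable_exp_neg_norm (n := n) (a * m) (by positivity)).const_mul (rexp (a * m))).mono' (by fun_prop) (Filter.Eventually.of_forall fun y => ?_)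
  rw [Real.norm_eq_abs, abs_of_pos (Real.exp_pos _), ← Real.exp_add, Real.exp_le_exp]
  nlinarith [h y]

lemma half_int (hK : IsCompact K) (hcv : Convex ℝ K) {g : Eu n → ℝ} (hg : Continuous g) (hg0 : ∀ x, 0 ≤ g x) (a : Eu n) (ha : a ∈ K) :
    ∫ x in K, g ((1/2:ℝ) • (a + x)) ≤ 2 ^ n * ∫ x in K, g x := by
  have hm := hK.measurableSet
  have hI : Integrable (K.indicator g) := (intK hK hg).integrable_indicator hm
  have hI2 : Integrable (fun x => K.indicator g ((1/2:ℝ) • (a + x))) :=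
    ((hI.comp_smul (by norm_num : (1/2:ℝ) ≠ 0)).comp_add_left a)
  have e : ∫ x, K.indicator g ((1/2:ℝ) • (a + x)) = 2 ^ n * ∫ x in K, g x := by
    rw [integral_add_left_eq_self (fun x => K.indicator g ((1/2:ℝ) • x)) a, Measure.integral_comp_smul, integral_indicator hm]
    simp
  rw [← e, ← integral_indicator hm]
  refine integral_mono ((intK hK (by fun_prop)).integrable_indicator hm) hI2 fun x => ?_
  simp only
  by_cases hx : x ∈ K
  · rw [Set.indicator_of_mem hx, Set.indicator_of_mem]
    rw [smul_add]
    exact hcv ha hx (by norm_num) (by norm_num) (by norm_num)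
  · rw [Set.indicator_of_notMem hx]
    exact Set.indicator_nonneg (fun _ _ => hg0 _) _

lemma h_bound (hK : IsCompact K) (hcv : Convex ℝ K) (h0 : volume K ≠ 0) (hc : ∫ x in K, x = 0) (a : Eu n) (ha : a ∈ K) (y : Eu n) :
    inner ℝ a y ≤ 2 * Ff K y + 2 * n * Real.log 2 := by
  have h := half_int hK hcv (cexp y) (fun x => (Real.exp_pos _).le) a ha
  have e : ∀ x, rexp (inner ℝ ((1/2:ℝ) • (a + x)) y) = rexp (inner ℝ a y / 2) * rexp (inner ℝ x ((1/2:ℝ) • y)) := by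
    intro x
    rw [← Real.exp_add, real_inner_smul_left, inner_add_left, real_inner_smul_right]; congr 1; ring
  simp_rw [e] at h
  rw [integral_const_mul] at h
  change _ * Zf K _ ≤ 2 ^ n * Zf K y at h
  have hv := volK_pos hK h0
  have z1 := Zf_pos hK h0 ((1/2:ℝ) • y)
  have z2 := Zf_pos hK h0 y
  have f1 := Ff_nonneg hK h0 hc ((1/2:ℝ) • y)
  rw [Ff, Real.log_div z1.ne' hv.ne'] at f1
  have := Real.log_le_log (by positivity) h
  rw [Real.log_mul (Real.exp_pos _).ne' z1.ne', Real.log_exp, Real.log_mul (by positivity) z2.ne', Real.log_pow] at this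
  rw [Ff, Real.log_div z2.ne' hv.ne']
  linarith

lemma compact_sub (hK : IsCompact K) : IsCompact (K - K) := by
  rw [sub_eq_add_neg]; exact hK.add hK.neg

lemma rogers_shephard (hK : IsCompact K) (hcv : Convex ℝ K) (h0 : volume K ≠ 0) :
    volume (K - K) ≤ 4 ^ n * volume K := by
  have hm := hK.measurableSet
  have hfin := (hK.measure_lt_top (μ := volume)).ne
  have hmD : MeasurableSet ((1/2:ℝ) • (K - K)) := ((compact_sub hK).smul (1/2:ℝ)).measurableSet
  have hsc : ∀ S : Set (Eu n), volume ((1/2:ℝ) • S) = (2^n)⁻¹ * volume S := by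
    intro S
    rw [Measure.addHaar_smul]
    congr 1
    simp
  let φ : Eu n → ENNReal := fun z => ∫⁻ x, K.indicator 1 x * K.indicator 1 (x - z)
  have h1 : ∫⁻ z, φ z = volume K * volume K := by
    simp only [φ]
    rw [lintegral_lintegral_swap]
    · have : ∀ x : Eu n, ∫⁻ z, K.indicator 1 x * K.indicator 1 (x - z) = K.indicator 1 x * volume K := by
        intro x
        rw [lintegral_const_mul _ (by exact (measurable_one.indicator hm).comp (by fun_prop)), lintegral_sub_left_eq_self (μ := volume) (fun z => K.indicator (1 : Eu n → ENNReal) z) x, lintegral_indicator_one hm]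
      simp_rw [this]
      rw [lintegral_mul_const _ (by exact (measurable_one.indicator hm)), lintegral_indicator_one hm]
    · apply Measurable.aemeasurable
      apply Measurable.mul
      · exact (measurable_one.indicator hm).comp measurable_snd
      · exact (measurable_one.indicator hm).comp (measurable_snd.sub measurable_fst)
  have h2 : ∀ z ∈ (1/2:ℝ) • (K - K), (2^n)⁻¹ * volume K ≤ φ z := by
    rintro _ ⟨_, ⟨a, ha, b, hb, rfl⟩, rfl⟩
    rw [← hsc, ← measure_preimage_add volume (-(1/2:ℝ) • a)]
    have hms : MeasurableSet ((fun x => -(1/2:ℝ) • a + x) ⁻¹' ((1/2:ℝ) • K)) :=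
      ((hK.smul (1/2:ℝ)).measurableSet).preimage (by fun_prop)
    rw [← lintegral_indicator_one hms]
    apply lintegral_mono
    intro x
    simp only
    by_cases hx : x ∈ ((fun x => -(1/2:ℝ) • a + x) ⁻¹' ((1/2:ℝ) • K))
    · obtain ⟨k, hk, hkx⟩ := hx
      simp only at hkx
      have ex : x = (1/2:ℝ) • a + (1/2:ℝ) • k := by rw [hkx]; module
      have m1 : x ∈ K := by rw [ex]; exact hcv ha hk (by norm_num) (by norm_num) (by norm_num)
      have m2 : x - (fun x => (1/2:ℝ) • x) ((fun x1 x2 => x1 - x2) a b) ∈ K := by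
        have : x - (fun x => (1/2:ℝ) • x) ((fun x1 x2 => x1 - x2) a b) = (1/2:ℝ) • b + (1/2:ℝ) • k := by
          rw [ex]; module
        rw [this]; exact hcv hb hk (by norm_num) (by norm_num) (by norm_num)
      rw [Set.indicator_of_mem m1, Set.indicator_of_mem m2]
      simp only [Pi.one_apply, mul_one]
      exact Set.indicator_le_self' (by simp) x
    · rw [Set.indicator_of_notMem hx]; exact zero_le
  have h3 : (2^n)⁻¹ * volume K * ((2^n)⁻¹ * volume (K - K)) ≤ volume K * volume K := by
    rw [← h1, ← hsc (K - K), ← setLIntegral_const]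
    exact (setLIntegral_mono' hmD h2).trans (setLIntegral_le_lintegral _ _)
  have h4 : volume K * volume (K - K) ≤ volume K * (4 ^ n * volume K) := by
    have e1 : (4:ENNReal) ^ n = 2 ^ n * 2 ^ n := by rw [← mul_pow]; norm_num
    have e2 : (2:ENNReal) ^ n * (2 ^ n)⁻¹ = 1 := ENNReal.mul_inv_cancel (by simp) (by simp)
    calc volume K * volume (K - K) = (2 ^ n * (2 ^ n)⁻¹) * (2 ^ n * (2 ^ n)⁻¹) * (volume K * volume (K - K)) := by rw [e2]; simp
      _ = 2 ^ n * 2 ^ n * ((2^n)⁻¹ * volume K * ((2^n)⁻¹ * volume (K - K))) := by ring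
      _ ≤ 2 ^ n * 2 ^ n * (volume K * volume K) := by gcongr
      _ = _ := by rw [e1]; ring
  exact (ENNReal.mul_le_mul_iff_right h0 hfin).1 h4
end C3


section D
variable {n : ℕ} {K : Set (Eu n)}

lemma I_lower (hK : IsCompact K) (hcv : Convex ℝ K) (h0 : volume K ≠ 0) (hc : ∫ x in K, x = 0) :
    (π / 16) ^ n ≤ (volume K).toReal * ∫ y, rexp (-4 * Ff K y) := by
  obtain ⟨R, hR⟩ := hK.isBounded.exists_norm_le
  have hFc := Ff_cont hK h0
  have hI4 := integrable_exp_F hK h0 hc 4 (by norm_num)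
  have h := upper_G (Gf K) (fun y => (Gf_hasFDerivAt hK h0 y).differentiableAt) (8 * (R ^ 2 + 1)) (by positivity)
    (fun x y => by
      have := Gf_lip hK hcv h0 hR x y
      nlinarith [norm_nonneg (x - y)])
    (fun x => (Ff_nonneg hK h0 hc x).trans (Ff_le_inner hK h0 x))
    (by
      have hG : Continuous (Gf K) := continuous_iff_continuousAt.2 fun y => (Gf_hasFDerivAt hK h0 y).continuousAt
      refine (integrable_exp_F hK h0 hc 2 (by norm_num)).mono' (by fun_prop) (Filter.Eventually.of_forall fun y => ?_)
      rw [Real.norm_eq_abs, abs_of_pos (Real.exp_pos _), Real.exp_le_exp]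
      linarith [Ff_le_inner hK h0 y])
    (Gf_mono hK h0) (Ff K) hFc (Ff_le_inner hK h0)
    (fun x a => by
      have := Ff_convex hK h0 x a (1/2) (1/2) (by norm_num) (by norm_num) (by norm_num)
      rw [← smul_add] at this
      linarith)
    (K - K) (compact_sub hK).measurableSet
    (fun x a => Set.sub_mem_sub (Gf_mem hK hcv h0 x) (Gf_mem hK hcv h0 a))
  have hI4' : Integrable (fun s => rexp (-4 * Ff K ((1/2:ℝ) • s))) := hI4.comp_smul (by norm_num)
  rw [← ofReal_integral_eq_lintegral_ofReal hI4' (Filter.Eventually.of_forall fun x => (Real.exp_pos _).le),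
    Measure.integral_comp_smul volume (fun s => rexp (-4 * Ff K s))] at h
  have hrs := rogers_shephard hK hcv h0
  set I := ∫ y, rexp (-4 * Ff K y) with hI
  have hI0 : 0 ≤ I := integral_nonneg fun x => (Real.exp_pos _).le
  have e : |((1/2:ℝ) ^ Module.finrank ℝ (Eu n))⁻¹| • I = 2 ^ n * I := by simp
  rw [e] at h
  have hv := volK_pos hK h0
  have h2 : ENNReal.ofReal (π ^ n) ≤ ENNReal.ofReal (2 ^ n * (2 ^ n * I * (4 ^ n * (volume K).toReal))) := by
    refine h.trans ?_
    rw [ENNReal.ofReal_mul (p := 2 ^ n) (q := 2 ^ n * I * _) (by positivity), ENNReal.ofReal_mul (p := 2 ^ n * I) (by positivity), ENNReal.ofReal_mul (p := 4 ^ n) (by positivity), ENNReal.ofReal_toReal hK.measure_lt_top.ne]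
    rw [ENNReal.ofReal_pow (by norm_num), ENNReal.ofReal_pow (by norm_num)]
    simp only [ENNReal.ofReal_ofNat]
    gcongr
  rw [ENNReal.ofReal_le_ofReal_iff (by positivity)] at h2
  rw [div_pow, div_le_iff₀ (by positivity)]
  have e16 : (16:ℝ) ^ n = 2 ^ n * 2 ^ n * 4 ^ n := by rw [← mul_pow, ← mul_pow]; norm_num
  rw [e16]; linarith

lemma two_exp_le (hn : 1 ≤ n) : rexp (-2 * n) * 2 ^ n ≤ 1 / 2 := by
  have h1 : rexp (-2 * n) = (rexp (-2)) ^ n := by rw [← Real.exp_nat_mul]; congr 1; ring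
  rw [h1, ← mul_pow]
  have h2 : rexp (-2) * 2 ≤ 1 / 2 := by
    rw [Real.exp_neg]
    have : (4:ℝ) ≤ rexp 2 := by
      have := Real.quadratic_le_exp_of_nonneg (x := 2) (by norm_num)
      norm_num at this; linarith
    rw [inv_mul_le_iff₀ (Real.exp_pos _)]; linarith
  calc (rexp (-2) * 2) ^ n ≤ (1/2) ^ n := pow_le_pow_left₀ (by positivity) h2 n
    _ ≤ (1/2) ^ 1 := pow_le_pow_of_le_one (by norm_num) (by norm_num) hn
    _ = 1/2 := by norm_num

lemma A_lower (hn : 1 ≤ n) (hK : IsCompact K) (hcv : Convex ℝ K) (h0 : volume K ≠ 0) (hc : ∫ x in K, x = 0) :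
    ENNReal.ofReal ((π / 16) ^ n / (2 * (volume K).toReal)) ≤ volume {y | Ff K y ≤ n} := by
  have hFc := Ff_cont hK h0
  have hI4 := integrable_exp_F hK h0 hc 4 (by norm_num)
  have hI2 := integrable_exp_F hK h0 hc 2 (by norm_num)
  have hI4' : Integrable (fun s => rexp (-4 * Ff K ((1/2:ℝ) • s))) := hI4.comp_smul (by norm_num)
  have hl := I_lower hK hcv h0 hc
  set I := ∫ y, rexp (-4 * Ff K y) with hI
  have hI0 : 0 ≤ I := integral_nonneg fun x => (Real.exp_pos _).le
  have hv := volK_pos hK h0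
  set A := {y | Ff K y ≤ n} with hA
  have hAm : MeasurableSet A := (isClosed_le hFc continuous_const).measurableSet
  have h1 : ∫ y, rexp (-2 * Ff K y) ≤ 2 ^ n * I := by
    have e : 2 ^ n * I = ∫ s, rexp (-4 * Ff K ((1/2:ℝ) • s)) := by
      rw [Measure.integral_comp_smul volume (fun s => rexp (-4 * Ff K s))]; simp [I]
    rw [e]
    refine integral_mono hI2 hI4' fun y => ?_
    simp only
    rw [Real.exp_le_exp]
    have := Ff_convex hK h0 y 0 (1/2) (1/2) (by norm_num) (by norm_num) (by norm_num)
    rw [smul_zero, add_zero, Ff_zero hK h0] at this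
    linarith
  have h2 : ENNReal.ofReal I ≤ volume A + ENNReal.ofReal (I / 2) := by
    rw [hI, ofReal_integral_eq_lintegral_ofReal hI4 (Filter.Eventually.of_forall fun x => (Real.exp_pos _).le),
      ← lintegral_add_compl _ hAm]
    refine add_le_add ?_ ?_
    · rw [← setLIntegral_one]
      refine setLIntegral_mono' hAm fun y hy => ?_
      rw [← ENNReal.ofReal_one]
      apply ENNReal.ofReal_le_ofReal
      rw [Real.exp_le_one_iff]
      linarith [Ff_nonneg hK h0 hc y]
    · calc ∫⁻ y in Aᶜ, ENNReal.ofReal (rexp (-4 * Ff K y)) ≤ ∫⁻ y in Aᶜ, ENNReal.ofReal (rexp (-2 * n) * rexp (-2 * Ff K y)) := by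
            refine setLIntegral_mono' hAm.compl fun y hy => ?_
            apply ENNReal.ofReal_le_ofReal
            rw [← Real.exp_add, Real.exp_le_exp]
            simp only [A, Set.mem_compl_iff, Set.mem_setOf_eq, not_le] at hy
            linarith
        _ ≤ ∫⁻ y, ENNReal.ofReal (rexp (-2 * n) * rexp (-2 * Ff K y)) := setLIntegral_le_lintegral _ _
        _ = ENNReal.ofReal (rexp (-2 * n) * ∫ y, rexp (-2 * Ff K y)) := by
            rw [← integral_const_mul, ofReal_integral_eq_lintegral_ofReal (hI2.const_mul _) (Filter.Eventually.of_forall fun x => by positivity)]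
        _ ≤ _ := by
            apply ENNReal.ofReal_le_ofReal
            calc rexp (-2 * n) * ∫ y, rexp (-2 * Ff K y) ≤ rexp (-2 * n) * (2 ^ n * I) := by gcongr
              _ = (rexp (-2 * n) * 2 ^ n) * I := by ring
              _ ≤ 1 / 2 * I := by gcongr; exact two_exp_le hn
              _ = I / 2 := by ring
  have h3 : ENNReal.ofReal (I / 2) ≤ volume A := by
    have : ENNReal.ofReal (I / 2) = ENNReal.ofReal I - ENNReal.ofReal (I / 2) := by
      rw [← ENNReal.ofReal_sub _ (by positivity)]; congr 1; ring
    rw [this]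
    exact tsub_le_iff_right.2 h2
  refine le_trans (ENNReal.ofReal_le_ofReal ?_) h3
  rw [div_le_div_iff₀ (by positivity) (by norm_num)]
  linarith

lemma exists_good_y (hn : 1 ≤ n) (hK : IsCompact K) (hcv : Convex ℝ K) (h0 : volume K ≠ 0) (hc : ∫ x in K, x = 0) :
    ∃ y, Ff K y ≤ n ∧ |(Hf K y).det| ≤ 4 * (16 / π) ^ n * (volume K).toReal ^ 2 := by
  by_contra hcon
  push Not at hcon
  have hA := A_lower hn hK hcv h0 hc
  have hFc := Ff_cont hK h0
  have hv := volK_pos hK h0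
  set δ := 4 * (16 / π) ^ n * (volume K).toReal ^ 2
  set A := {y | Ff K y ≤ n}
  have hAm : MeasurableSet A := (isClosed_le hFc continuous_const).measurableSet
  have hinj : Set.InjOn (Gf K) A := by
    intro x _ y _ hxy
    by_contra hne
    have := Gf_mono hK h0 x y hne
    rw [hxy, sub_self, inner_zero_right] at this
    exact lt_irrefl _ this
  have h1 := lintegral_abs_det_fderiv_eq_addHaar_image volume hAm (fun y _ => (Gf_hasFDerivAt hK h0 y).hasFDerivWithinAt) hinj
  have h2 : volume (Gf K '' A) ≤ volume K := measure_mono (by rintro _ ⟨y, _, rfl⟩; exact Gf_mem hK hcv h0 y)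
  have h3 : ENNReal.ofReal δ * volume A ≤ volume K := by
    rw [← setLIntegral_const]
    refine le_trans ?_ (h1.le.trans h2)
    exact setLIntegral_mono' hAm fun y hy => ENNReal.ofReal_le_ofReal (hcon y hy).le
  have h4 : ENNReal.ofReal (δ * ((π / 16) ^ n / (2 * (volume K).toReal))) ≤ ENNReal.ofReal (volume K).toReal := by
    rw [ENNReal.ofReal_mul (by positivity), ENNReal.ofReal_toReal hK.measure_lt_top.ne]
    exact le_trans (by gcongr) h3
  rw [ENNReal.ofReal_le_ofReal_iff hv.le] at h4
  have e : δ * ((π / 16) ^ n / (2 * (volume K).toReal)) = 2 * (volume K).toReal := by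
    simp only [δ]
    have : (16 / π) ^ n * (π / 16) ^ n = 1 := by
      rw [← mul_pow]
      have : 16 / π * (π / 16) = 1 := by field_simp
      rw [this, one_pow]
    field_simp
    linear_combination 4 * this
  linarith
end D


section E1
variable {n : ℕ} {K : Set (Eu n)}

lemma exists_sqrt (H : Eu n →ₗ[ℝ] Eu n) (hH : H.IsPositive) :
    ∃ T : Eu n →ₗ[ℝ] Eu n, (∀ v w, inner ℝ (T v) w = inner ℝ v (T w)) ∧ T ∘ₗ T = H := by
  have hfr : Module.finrank ℝ (Eu n) = n := by simp
  let u := hH.isSymmetric.eigenvectorBasis hfr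
  let l := hH.isSymmetric.eigenvalues hfr
  have hl : ∀ i, 0 ≤ l i := hH.nonneg_eigenvalues hfr
  let T : Eu n →ₗ[ℝ] Eu n := ∑ i, (√(l i)) • ((innerSL ℝ (u i)).smulRight (u i)).toLinearMap
  have hT : ∀ v, T v = ∑ i, (√(l i)) • (inner ℝ (u i) v) • u i := by
    intro v; simp [T]
  have hTu : ∀ j, T (u j) = √(l j) • u j := by
    intro j
    rw [hT, Finset.sum_eq_single j]
    · simp
    · intro i _ hij
      rw [u.orthonormal.inner_eq_zero hij]; simp
    · simp
  refine ⟨T, ?_, ?_⟩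
  · intro v w
    rw [hT, hT, sum_inner, inner_sum]
    congr 1; ext i
    simp only [real_inner_smul_left, real_inner_smul_right, real_inner_comm v]
    ring
  · apply u.toBasis.ext
    intro j
    simp only [LinearMap.comp_apply, OrthonormalBasis.coe_toBasis]
    rw [hTu, map_smul, hTu, smul_smul, Real.mul_self_sqrt (hl j)]
    exact (hH.isSymmetric.apply_eigenvectorBasis hfr j).symm

lemma ball_vol_le : volume (Metric.ball (0 : Eu n) (√(2 * n))) ≤ ENNReal.ofReal (rexp 7 ^ n) := by
  have hIntg := GaussianFourier.integral_rexp_neg_mul_sq_norm (V := Eu n) Real.pi_pos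
  rw [div_self Real.pi_pos.ne', Real.one_rpow] at hIntg
  have hI : Integrable (fun v : Eu n => rexp (-π * ‖v‖ ^ 2)) := by
    by_contra h
    rw [integral_undef h] at hIntg; norm_num at hIntg
  rw [← setLIntegral_one]
  have h1 : ∫⁻ x in Metric.ball (0 : Eu n) (√(2 * n)), 1 ≤ ∫⁻ x in Metric.ball (0 : Eu n) (√(2 * n)), ENNReal.ofReal (rexp 7 ^ n * rexp (-π * ‖x‖ ^ 2)) := by
    refine setLIntegral_mono' measurableSet_ball fun x hx => ?_
    rw [← ENNReal.ofReal_one]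
    apply ENNReal.ofReal_le_ofReal
    rw [← Real.exp_nat_mul, ← Real.exp_add]
    apply Real.one_le_exp
    rw [mem_ball_zero_iff, Real.lt_sqrt (norm_nonneg _)] at hx
    nlinarith [Real.pi_lt_d2, Real.pi_pos, sq_nonneg ‖x‖]
  refine h1.trans ((setLIntegral_le_lintegral _ _).trans ?_)
  rw [← ofReal_integral_eq_lintegral_ofReal (hI.const_mul _) (Filter.Eventually.of_forall fun x => by positivity), integral_const_mul, hIntg, mul_one]

lemma Hf_pos (hK : IsCompact K) (h0 : volume K ≠ 0) (y v : Eu n) (hv : v ≠ 0) : 0 < inner ℝ (Hf K y v) v := by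
  rw [inner_Hf hK h0]
  refine mul_pos (inv_pos.2 (Zf_pos hK h0 y)) ?_
  refine pos_int hK h0 (by fun_prop) (fun x => mul_nonneg (Real.exp_pos _).le (mul_self_nonneg _)) v hv (inner ℝ (Gf K y) v) fun x hx => ?_
  rw [inner_sub_left]
  exact mul_pos (Real.exp_pos _) (mul_self_pos.2 (sub_ne_zero.2 hx))

lemma exists_ellipsoid (hn : 1 ≤ n) (hK : IsCompact K) (hcv : Convex ℝ K) (h0 : volume K ≠ 0) (hc : ∫ x in K, x = 0) :
    ∃ (T : Eu n ≃ₗ[ℝ] Eu n) (b : Eu n),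
      volume ((fun u => b + T u) '' Metric.ball 0 (√(2 * n))) ≤ ENNReal.ofReal ((6 * rexp 7) ^ n) * volume K ∧
      volume K ≤ ENNReal.ofReal ((8 * rexp 2) ^ n) * volume (K ∩ ((fun u => b + T u) '' Metric.ball 0 (√(2 * n)))) := by
  obtain ⟨y, hy, hdet⟩ := exists_good_y hn hK hcv h0 hc
  have hv := volK_pos hK h0
  have hz := Zf_pos hK h0 y
  set b := Gf K y with hb
  have hsym : ∀ v w, inner ℝ (Hf K y v) w = inner ℝ v (Hf K y w) := by
    intro v w
    rw [real_inner_comm (Hf K y w) v, inner_Hf hK h0, inner_Hf hK h0]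
    simp_rw [mul_comm (inner ℝ _ v) (inner ℝ _ w)]
  have hpos : (Hf K y : Eu n →ₗ[ℝ] Eu n).IsPositive := by
    refine ⟨hsym, fun v => ?_⟩
    by_cases h : v = 0
    · simp [h]
    · simpa using (Hf_pos hK h0 y v h).le
  obtain ⟨T0, hTs, hTT⟩ := exists_sqrt _ hpos
  have hTT' : ∀ v, T0 (T0 v) = Hf K y v := fun v => by
    have := congrArg (fun L => L v) hTT; simpa using this
  have hinj : Function.Injective T0 := by
    rw [injective_iff_map_eq_zero]
    intro v hv
    by_contra hne
    have := Hf_pos hK h0 y v hne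
    rw [← hTT', hv] at this; simp at this
  let T : Eu n ≃ₗ[ℝ] Eu n := LinearEquiv.ofInjectiveEndo T0 hinj
  have hTa : ∀ v, T v = T0 v := fun v => rfl
  let e : Fin n → Eu n := fun i => EuclideanSpace.basisFun (Fin n) ℝ i
  have hnorm : ∀ u : Eu n, ∑ i, (inner ℝ u (e i)) ^ 2 = ‖u‖ ^ 2 := fun u =>
    OrthonormalBasis.sum_sq_inner_left (EuclideanSpace.basisFun (Fin n) ℝ) u
  let q : Eu n → ℝ := fun x => ∑ i, (inner ℝ (x - b) (T.symm (e i))) ^ 2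
  have hqc : Continuous q := by fun_prop
  have hq : ∀ u, q (b + T u) = ‖u‖ ^ 2 := by
    intro u
    simp only [q, add_sub_cancel_left]
    rw [← hnorm]
    congr 1; ext i
    rw [hTa, hTs, ← hTa, LinearEquiv.apply_symm_apply]
  set E := (fun u => b + T u) '' Metric.ball (0 : Eu n) (√(2 * n)) with hE
  have hEq : ∀ x, x ∈ E ↔ q x < 2 * n := by
    intro x
    constructor
    · rintro ⟨u, hu, rfl⟩
      rw [hq]
      rwa [mem_ball_zero_iff, Real.lt_sqrt (norm_nonneg _)] at hu
    · intro hx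
      have hx' : b + T (T.symm (x - b)) = x := by simp
      refine ⟨T.symm (x - b), ?_, hx'⟩
      rw [mem_ball_zero_iff, Real.lt_sqrt (norm_nonneg _), ← hq, hx']
      exact hx
  have hEm : MeasurableSet E := by
    have : E = {x | q x < 2 * n} := Set.ext hEq
    rw [this]; exact (isOpen_lt hqc continuous_const).measurableSet
  have hqint : ∫ x in K, rexp (inner ℝ x y) * q x = n * Zf K y := by
    simp only [q, Finset.mul_sum]
    rw [integral_finsetSum _ (fun i _ => intK' hK (by fun_prop))]
    have : ∀ i, ∫ x in K, rexp (inner ℝ x y) * (inner ℝ (x - b) (T.symm (e i))) ^ 2 = Zf K y := by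
      intro i
      have h := inner_Hf hK h0 y (T.symm (e i)) (T.symm (e i))
      rw [← hTT', hTs, ← hTa, LinearEquiv.apply_symm_apply] at h
      have h1 : inner ℝ (e i) (e i) = (1:ℝ) := by simp [e]
      rw [h1] at h
      field_simp at h
      exact h.symm
    simp [this]
  refine ⟨T, b, ?_, ?_⟩
  · have e1 : E = (fun x => b + x) '' ((T : Eu n →ₗ[ℝ] Eu n) '' Metric.ball (0 : Eu n) (√(2 * n))) := by
      rw [hE, Set.image_image]; rfl
    have e2 : volume E = ENNReal.ofReal |LinearMap.det T0| * volume (Metric.ball (0 : Eu n) (√(2 * n))) := by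
      rw [e1, Set.image_add_left, measure_preimage_add, Measure.addHaar_image_linearMap]; rfl
    have e3 : LinearMap.det T0 ^ 2 = (Hf K y).det := by
      rw [sq, ← LinearMap.det_comp, hTT]
    have e4 : |LinearMap.det T0| ≤ 6 ^ n * (volume K).toReal := by
      apply abs_le_of_sq_le_sq _ (by positivity)
      rw [e3]
      refine (le_abs_self _).trans (hdet.trans ?_)
      rw [mul_pow]
      gcongr
      have : (16 / π) ≤ 9 := by rw [div_le_iff₀ Real.pi_pos]; linarith [Real.pi_gt_three]
      calc 4 * (16 / π) ^ n ≤ 4 ^ n * 9 ^ n := by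
            gcongr
            exact le_self_pow₀ (by norm_num) (by omega)
        _ = (6 ^ n) ^ 2 := by rw [← mul_pow, ← pow_mul, mul_comm n 2, pow_mul]; norm_num
    rw [e2]
    calc _ ≤ ENNReal.ofReal (6 ^ n * (volume K).toReal) * ENNReal.ofReal (rexp 7 ^ n) := by
          gcongr; exact ball_vol_le
      _ = _ := by
          rw [mul_pow, ENNReal.ofReal_mul (p := 6 ^ n) (q := (volume K).toReal) (by positivity), ENNReal.ofReal_mul (p := 6 ^ n) (by positivity), ENNReal.ofReal_toReal hK.measure_lt_top.ne]
          ring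
  · have hn0 : (0:ℝ) < n := by exact_mod_cast hn
    set M : ℝ := rexp (2 * n + 2 * n * Real.log 2)
    have hM : M = (4 * rexp 2) ^ n := by
      simp only [M]
      rw [Real.exp_add, mul_pow, mul_comm, mul_comm (2 * (n:ℝ)) (Real.log 2), Real.exp_mul, Real.exp_log (by norm_num)]
      congr 1
      · rw [show (2:ℝ) * n = ((2 * n : ℕ) : ℝ) by push_cast; ring, Real.rpow_natCast, pow_mul]; norm_num
      · rw [← Real.exp_nat_mul]; congr 1; ring
    have hfin : volume (K ∩ E) ≠ ⊤ := ((measure_mono Set.inter_subset_left).trans_lt hK.measure_lt_top).ne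
    have g1 : Zf K y / 2 ≤ M * (volume (K ∩ E)).toReal := by
      have i1 : ∫ x in K, (rexp (inner ℝ x y) - (2 * n : ℝ)⁻¹ * (rexp (inner ℝ x y) * q x)) = Zf K y / 2 := by
        rw [integral_sub (intK hK (by fun_prop)) (intK hK (by fun_prop)), integral_const_mul, hqint]
        change Zf K y - _ = _
        field_simp; ring
      rw [← i1]
      have i2 : ∫ x in K, E.indicator (fun _ => M) x = M * (volume (K ∩ E)).toReal := by
        rw [setIntegral_indicator hEm, setIntegral_const, smul_eq_mul, mul_comm]; rfl
      rw [← i2]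
      apply setIntegral_mono_on (intK hK (by fun_prop)) ?_ hK.measurableSet
      · intro x hx
        have hq0 : 0 ≤ q x := Finset.sum_nonneg fun i _ => sq_nonneg _
        by_cases hxE : x ∈ E
        · rw [Set.indicator_of_mem hxE]
          have hb1 := h_bound hK hcv h0 hc x hx y
          have hb2 : rexp (inner ℝ x y) ≤ M := by
            rw [Real.exp_le_exp]; linarith
          have : 0 ≤ (2 * n : ℝ)⁻¹ * (rexp (inner ℝ x y) * q x) := by positivity
          linarith
        · rw [Set.indicator_of_notMem hxE]
          rw [hEq, not_lt] at hxE
          have : rexp (inner ℝ x y) - (2 * n : ℝ)⁻¹ * (rexp (inner ℝ x y) * q x) = rexp (inner ℝ x y) * (2 * n : ℝ)⁻¹ * (2 * n - q x) := by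
            field_simp
          rw [this]
          exact mul_nonpos_of_nonneg_of_nonpos (by positivity) (by linarith)
      · have := (intK hK (continuous_const (y := M)))
        exact Integrable.indicator this hEm
    have g2 : (volume K).toReal ≤ Zf K y := by
      have := Ff_nonneg hK h0 hc y
      rw [Ff] at this
      have h3 := (Real.le_log_iff_exp_le (by positivity)).1 this
      rw [Real.exp_zero, le_div_iff₀ hv] at h3
      linarith
    have g3 : (volume K).toReal ≤ (8 * rexp 2) ^ n * (volume (K ∩ E)).toReal := by
      have : 2 * M ≤ (8 * rexp 2) ^ n := by
        rw [hM, show (8:ℝ) * rexp 2 = 2 * (4 * rexp 2) by ring, mul_pow 2]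
        gcongr
        exact le_self_pow₀ (by norm_num) (by omega)
      have h5 : (2 * M) * (volume (K ∩ E)).toReal ≤ (8 * rexp 2) ^ n * (volume (K ∩ E)).toReal := by gcongr
      linarith
    rw [← ENNReal.ofReal_toReal (hK.measure_lt_top (μ := volume)).ne, ← ENNReal.ofReal_toReal hfin, ← ENNReal.ofReal_mul (by positivity)]
    exact ENNReal.ofReal_le_ofReal g3
end E1

section F1
variable {n : ℕ} {K : Set (Eu n)}

lemma exists_ellipsoid_uncentered (hn : 1 ≤ n) (hK : IsCompact K) (hcv : Convex ℝ K) (h0 : volume K ≠ 0) :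
    ∃ (T : Eu n ≃ₗ[ℝ] Eu n) (b : Eu n),
      volume ((fun u => b + T u) '' Metric.ball 0 (√(2 * n))) ≤ ENNReal.ofReal ((6 * rexp 7) ^ n) * volume K ∧
      volume K ≤ ENNReal.ofReal ((8 * rexp 2) ^ n) * volume (K ∩ ((fun u => b + T u) '' Metric.ball 0 (√(2 * n)))) := by
  have hv := volK_pos hK h0
  set b0 : Eu n := (volume K).toReal⁻¹ • ∫ x in K, x with hb0
  set K' := (fun x => b0 + x) ⁻¹' K with hK'
  have hvK' : volume K' = volume K := measure_preimage_add _ _ _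
  have hK'c : IsCompact K' := (Homeomorph.addLeft b0).isCompact_preimage.2 hK
  have hK'cv : Convex ℝ K' := hcv.translate_preimage_right b0
  have hcen : ∫ x in K', x = 0 := by
    have h1 := MeasurePreserving.setIntegral_preimage_emb (measurePreserving_add_left volume b0)
      (measurableEmbedding_addLeft b0) (fun x => x - b0) K
    simp only [add_sub_cancel_left] at h1
    rw [hK', h1, integral_sub (intK hK (φ := fun x => x) continuous_id) (intK hK continuous_const), setIntegral_const]
    rw [Measure.real, hb0, smul_smul, mul_inv_cancel₀ hv.ne', one_smul, sub_self]
  obtain ⟨T, b, h1, h2⟩ := exists_ellipsoid hn hK'c hK'cv (by rwa [hvK']) hcen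
  have himg : (fun x => b0 + x) ⁻¹' ((fun u => (b0 + b) + T u) '' Metric.ball 0 (√(2 * n))) = (fun u => b + T u) '' Metric.ball 0 (√(2 * n)) := by
    ext x
    simp only [Set.mem_preimage, Set.mem_image]
    constructor
    · rintro ⟨u, hu, h⟩
      refine ⟨u, hu, ?_⟩
      rw [add_assoc] at h; exact add_left_cancel h
    · rintro ⟨u, hu, h⟩
      refine ⟨u, hu, ?_⟩
      rw [← h, add_assoc]
  refine ⟨T, b0 + b, ?_, ?_⟩
  · rw [← measure_preimage_add volume b0, himg, ← hvK']; exact h1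
  · rw [← measure_preimage_add volume b0 (K ∩ _), Set.preimage_inter, himg, ← hvK']; exact h2

lemma vol_ell (T : Eu n ≃ₗ[ℝ] Eu n) (b : Eu n) {r : ℝ} (hr : 0 < r) :
    volume ((fun u => b + T u) '' Metric.ball 0 r) =
      ENNReal.ofReal (r ^ n) * (ENNReal.ofReal |LinearMap.det (T : Eu n →ₗ[ℝ] Eu n)| * volume (Metric.ball (0 : Eu n) 1)) := by
  have e1 : ((fun u => b + T u) '' Metric.ball 0 r) = (fun x => b + x) '' ((T : Eu n →ₗ[ℝ] Eu n) '' Metric.ball (0 : Eu n) r) := by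
    rw [Set.image_image]; rfl
  rw [e1, Set.image_add_left, measure_preimage_add, Measure.addHaar_image_linearMap,
    Measure.addHaar_ball_of_pos _ _ hr]
  simp only [finrank_euclideanSpace, Fintype.card_fin]
  ring

lemma exists_unit_ellipsoid (hn : 1 ≤ n) (hK : IsCompact K) (hcv : Convex ℝ K) (h0 : volume K ≠ 0)
    (h32 : volume K ≤ ENNReal.ofReal (32 ^ n)) :
    ∃ (T : Eu n ≃ₗ[ℝ] Eu n) (b : Eu n) (ρ : ℝ), 0 < ρ ∧
      volume ((fun u => b + T u) '' Metric.ball 0 ρ) = 1 ∧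
      volume K ≤ ENNReal.ofReal ((8 * rexp 2 * (192 * rexp 7)) ^ n) * volume (K ∩ ((fun u => b + T u) '' Metric.ball 0 ρ)) := by
  obtain ⟨T, b, h1, h2⟩ := exists_ellipsoid_uncentered hn hK hcv h0
  have hn0 : n ≠ 0 := by omega
  have hnr : (0:ℝ) < n := by positivity
  set D : ℝ := 192 * rexp 7 with hD
  have hDpos : 0 < D := by positivity
  have hD1 : 1 ≤ D := by
    have := Real.add_one_le_exp (7:ℝ); rw [hD]; linarith
  set r := √(2 * n) with hr
  have hrpos : 0 < r := by positivity
  set κ : ENNReal := ENNReal.ofReal |LinearMap.det (T : Eu n →ₗ[ℝ] Eu n)| * volume (Metric.ball (0 : Eu n) 1) with hκ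
  have hdet : LinearMap.det (T : Eu n →ₗ[ℝ] Eu n) ≠ 0 := (LinearEquiv.isUnit_det' T).ne_zero
  have hκ0 : κ ≠ 0 := by
    apply mul_ne_zero
    · simpa using hdet
    · exact (Metric.measure_ball_pos _ _ one_pos).ne'
  have hκt : κ ≠ ⊤ := ENNReal.mul_ne_top ENNReal.ofReal_ne_top measure_ball_lt_top.ne
  set k := κ.toReal with hk
  have hkpos : 0 < k := ENNReal.toReal_pos hκ0 hκt
  have hkk : κ = ENNReal.ofReal k := (ENNReal.ofReal_toReal hκt).symm
  set ρ : ℝ := (k⁻¹) ^ ((n:ℝ)⁻¹) with hρ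
  have hρpos : 0 < ρ := by positivity
  have hρn : ρ ^ n = k⁻¹ := Real.rpow_inv_natCast_pow (by positivity) hn0
  have hrD : r ≤ D * ρ := by
    have h3 : ENNReal.ofReal (r ^ n * k) ≤ ENNReal.ofReal (D ^ n) := by
      rw [vol_ell T b hrpos, ← hκ, hkk, ← ENNReal.ofReal_mul (by positivity)] at h1
      refine h1.trans ((mul_le_mul_right h32 _).trans ?_)
      rw [← ENNReal.ofReal_mul (by positivity), ← mul_pow]
      apply le_of_eq; congr 2; rw [hD]; ring
    rw [ENNReal.ofReal_le_ofReal_iff (by positivity)] at h3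
    apply le_of_pow_le_pow_left₀ hn0 (by positivity)
    rw [mul_pow, hρn, ← div_eq_mul_inv, le_div_iff₀ hkpos]; exact h3
  have hne : (K ∩ ((fun u => b + T u) '' Metric.ball 0 r)).Nonempty := by
    rw [Set.nonempty_iff_ne_empty]
    intro h
    rw [h] at h2; simp at h2; exact h0 h2
  obtain ⟨z, hzK, uz, huz, hz⟩ := hne
  simp only at hz
  have hDi : D⁻¹ ≤ 1 := inv_le_one_of_one_le₀ hD1
  have hDi0 : 0 < D⁻¹ := by positivity
  refine ⟨T, (1 - D⁻¹) • z + D⁻¹ • b, ρ, hρpos, ?_, ?_⟩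
  · rw [vol_ell T _ hρpos, ← hκ, hkk, ← ENNReal.ofReal_mul (by positivity), hρn, inv_mul_cancel₀ hkpos.ne', ENNReal.ofReal_one]
  · set E' := (fun u => ((1 - D⁻¹) • z + D⁻¹ • b) + T u) '' Metric.ball 0 ρ with hE'
    have hsub : (fun x => (1 - D⁻¹) • z + x) '' (D⁻¹ • (K ∩ ((fun u => b + T u) '' Metric.ball 0 r))) ⊆ K ∩ E' := by
      rintro _ ⟨_, ⟨x, ⟨hxK, u, hu, hx⟩, rfl⟩, rfl⟩
      constructor
      · exact hcv hzK hxK (by linarith) hDi0.le (by ring)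
      · refine ⟨D⁻¹ • u, ?_, ?_⟩
        · rw [mem_ball_zero_iff, norm_smul, Real.norm_of_nonneg hDi0.le, inv_mul_lt_iff₀ hDpos]
          rw [mem_ball_zero_iff] at hu
          exact hu.trans_le hrD
        · simp only at hx ⊢
          rw [← hx, map_smul, smul_add]; abel
    have h4 := measure_mono (μ := volume) hsub
    rw [Set.image_add_left, measure_preimage_add, Measure.addHaar_smul] at h4
    simp only [finrank_euclideanSpace, Fintype.card_fin] at h4
    rw [abs_of_pos (by positivity)] at h4
    have h5 : volume (K ∩ ((fun u => b + T u) '' Metric.ball 0 r)) ≤ ENNReal.ofReal (D ^ n) * volume (K ∩ E') := by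
      refine le_trans ?_ (mul_le_mul_right h4 _)
      rw [← mul_assoc, ← ENNReal.ofReal_mul (by positivity), ← mul_pow, mul_inv_cancel₀ hDpos.ne']
      simp
    refine h2.trans ((mul_le_mul_right h5 _).trans ?_)
    rw [← mul_assoc, ← ENNReal.ofReal_mul (by positivity), ← mul_pow]
end F1


section F2
variable {n : ℕ} {f : Eu n → ℝ}

lemma lc_convex (hf : IsLogConcave f) {t : ℝ} (ht : 0 < t) : Convex ℝ {x | t ≤ f x} := by
  intro x hx y hy a b ha hb hab
  have hb' : b = 1 - a := by linarith
  subst hb'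
  refine le_trans ?_ (hf.2 x y a ha (by linarith))
  calc t = t ^ a * t ^ (1 - a) := by rw [← Real.rpow_add ht]; simp
    _ ≤ _ := by
      have hx' : t ≤ f x := hx
      have hy' : t ≤ f y := hy
      have := hf.1 x
      gcongr

lemma lc_half (hf : IsLogConcave f) (x0 : Eu n) :
    ENNReal.ofReal (√(f x0)) * ∫⁻ x, ENNReal.ofReal (√(f x)) ≤
      ENNReal.ofReal (2 ^ n) * ∫⁻ x, ENNReal.ofReal (f x) := by
  have h12 : (1/2 : ℝ) ≠ 0 := by norm_num
  set G : Eu n → ENNReal := fun x => ENNReal.ofReal (f ((1/2:ℝ) • x0 + x)) with hG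
  have h1 : ∫⁻ x, G ((1/2:ℝ) • x) = ENNReal.ofReal (2 ^ n) * ∫⁻ x, ENNReal.ofReal (f x) := by
    have e1 := lintegral_map_equiv (μ := (volume : Measure (Eu n))) G (Homeomorph.smulOfNeZero (1/2:ℝ) h12).toMeasurableEquiv
    have e2 : Measure.map (⇑(Homeomorph.smulOfNeZero (α := Eu n) (1/2:ℝ) h12).toMeasurableEquiv) volume
        = ENNReal.ofReal (2 ^ n) • (volume : Measure (Eu n)) := by
      have := Measure.map_addHaar_smul (volume : Measure (Eu n)) h12
      simp only [finrank_euclideanSpace, Fintype.card_fin] at this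
      rw [show |(((1:ℝ)/2) ^ n)⁻¹| = 2 ^ n by rw [abs_of_pos (by positivity)]; simp] at this
      exact this
    rw [e2, lintegral_smul_measure] at e1
    refine e1.symm.trans ?_
    rw [smul_eq_mul, hG, lintegral_add_left_eq_self (fun x => ENNReal.ofReal (f x))]
  rw [← h1, ← lintegral_const_mul' _ _ ENNReal.ofReal_ne_top]
  apply lintegral_mono
  intro x
  simp only [hG]
  rw [← ENNReal.ofReal_mul (Real.sqrt_nonneg _)]
  apply ENNReal.ofReal_le_ofReal
  have := hf.2 x0 x (1/2) (by norm_num) (by norm_num)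
  rw [Real.sqrt_eq_rpow, Real.sqrt_eq_rpow]
  convert this using 3 <;> norm_num

lemma lc_bdd (hf : IsLogConcave f) (h1 : ∫⁻ x, ENNReal.ofReal (f x) = 1) :
    ∃ C, ∀ x, f x ≤ C := by
  set I := ∫⁻ x, ENNReal.ofReal (√(f x)) with hI
  have hhalf := lc_half hf
  rw [h1, ← hI, mul_one] at hhalf
  -- positive level set of positive measure
  have hex : ∃ m : ℕ, volume {x | (1 / ((m:ℝ) + 1)) ≤ f x} ≠ 0 := by
    by_contra hcon
    push Not at hcon
    have h2 : ∀ᵐ x, ENNReal.ofReal (f x) = 0 := by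
      have h3 : volume (⋃ m : ℕ, {x | (1 / ((m:ℝ) + 1)) ≤ f x}) = 0 := measure_iUnion_null hcon
      refine measure_mono_null ?_ h3
      intro x hx
      have hx' : 0 < f x := by simpa using hx
      obtain ⟨m, hm⟩ := exists_nat_one_div_lt hx'
      exact Set.mem_iUnion.2 ⟨m, hm.le⟩
    rw [lintegral_congr_ae h2] at h1
    simp at h1
  obtain ⟨m, hm⟩ := hex
  set ε : ℝ := 1 / ((m:ℝ) + 1) with hε
  have hεpos : 0 < ε := by positivity
  have hI0 : I ≠ 0 := by
    have hnm : NullMeasurableSet {x | ε ≤ f x} volume := (lc_convex hf hεpos).nullMeasurableSet _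
    have : ENNReal.ofReal (√ε) * volume {x | ε ≤ f x} ≤ I := by
      rw [← lintegral_indicator_const₀ hnm]
      apply lintegral_mono
      intro x
      by_cases hx : x ∈ {x | ε ≤ f x}
      · rw [Set.indicator_of_mem hx]
        exact ENNReal.ofReal_le_ofReal (Real.sqrt_le_sqrt hx)
      · rw [Set.indicator_of_notMem hx]; exact zero_le
    intro h0
    rw [h0] at this
    have h3 : ENNReal.ofReal √ε ≠ 0 := by
      simp only [ne_eq, ENNReal.ofReal_eq_zero, not_le]; positivity
    simp only [nonpos_iff_eq_zero, mul_eq_zero] at this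
    tauto
  have hIt : I ≠ ⊤ := by
    have hne : ∃ x0, ε ≤ f x0 := by
      by_contra hc
      push Not at hc
      apply hm
      have : {x | ε ≤ f x} = ∅ := by ext x; simpa using hc x
      rw [this]; simp
    obtain ⟨x0, hx0⟩ := hne
    intro htop
    have := hhalf x0
    rw [htop, ENNReal.mul_top] at this
    · exact absurd this (by simp)
    · simp only [ne_eq, ENNReal.ofReal_eq_zero, not_le]; 
      exact Real.sqrt_pos.2 (hεpos.trans_le hx0)
  have hIp : 0 < I.toReal := ENNReal.toReal_pos hI0 hIt
  refine ⟨(2 ^ n / I.toReal) ^ 2, fun x => ?_⟩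
  have := hhalf x
  rw [← ENNReal.ofReal_toReal hIt, ← ENNReal.ofReal_mul (Real.sqrt_nonneg _), ENNReal.ofReal_le_ofReal_iff (by positivity)] at this
  rw [← le_div_iff₀ hIp] at this
  calc f x = √(f x) ^ 2 := (Real.sq_sqrt (hf.1 x)).symm
    _ ≤ _ := by gcongr

lemma lc_peak (hf : IsLogConcave f) (h1 : ∫⁻ x, ENNReal.ofReal (f x) = 1)
    (hs : 1 ≤ essSup (fun x => ENNReal.ofReal (f x)) volume) :
    ∃ x0, 1 / 2 ≤ f x0 ∧ ∀ x, f x ≤ 2 * f x0 := by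
  obtain ⟨C, hC⟩ := lc_bdd hf h1
  have hbdd : BddAbove (Set.range f) := ⟨C, by rintro _ ⟨x, rfl⟩; exact hC x⟩
  set S := ⨆ x, f x with hS
  have hle : ∀ x, f x ≤ S := fun x => le_ciSup hbdd x
  have hS1 : 1 ≤ S := by
    have : essSup (fun x => ENNReal.ofReal (f x)) volume ≤ ENNReal.ofReal S :=
      essSup_le_of_ae_le _ (Filter.Eventually.of_forall fun x => ENNReal.ofReal_le_ofReal (hle x))
    exact ENNReal.one_le_ofReal.1 (hs.trans this)
  obtain ⟨x0, hx0⟩ := exists_lt_of_lt_ciSup (show S / 2 < ⨆ x, f x by rw [← hS]; linarith)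
  exact ⟨x0, by linarith, fun x => by linarith [hle x]⟩

lemma exists_trunc {K0 : Set (Eu n)} (hcv : Convex ℝ K0) (h0 : volume K0 ≠ 0) (ht : volume K0 ≠ ⊤) :
    ∃ K, IsCompact K ∧ Convex ℝ K ∧ volume K0 / 2 ≤ volume K ∧ volume K ≤ volume K0 ∧
      ∀ E, volume (K ∩ E) ≤ volume (K0 ∩ E) := by
  have hU : (⋃ m : ℕ, K0 ∩ Metric.closedBall 0 (m:ℝ)) = K0 := by
    rw [← Set.inter_iUnion, Metric.iUnion_closedBall_nat, Set.inter_univ]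
  have hmono : Monotone (fun m : ℕ => K0 ∩ Metric.closedBall 0 (m:ℝ)) := by
    intro a b hab
    exact Set.inter_subset_inter_right _ (Metric.closedBall_subset_closedBall (by exact_mod_cast hab))
  have hlim := tendsto_measure_iUnion_atTop (μ := (volume : Measure (Eu n))) hmono
  rw [hU] at hlim
  obtain ⟨m, hm⟩ := (hlim.eventually (lt_mem_nhds (ENNReal.half_lt_self h0 ht))).exists
  set L := K0 ∩ Metric.closedBall 0 (m:ℝ) with hL
  have hLc : Convex ℝ L := hcv.inter (convex_closedBall _ _)
  have hE : ∀ E, volume (closure L ∩ E) ≤ volume (K0 ∩ E) := by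
    intro E
    have hsub : closure L ∩ E ⊆ (K0 ∩ E) ∪ frontier L := by
      rintro x ⟨hx, hxE⟩
      by_cases hxL : x ∈ L
      · exact Or.inl ⟨hxL.1, hxE⟩
      · exact Or.inr ⟨hx, fun h => hxL (interior_subset h)⟩
    refine (measure_mono hsub).trans ((measure_union_le _ _).trans ?_)
    rw [hLc.addHaar_frontier volume, add_zero]
  refine ⟨closure L, ?_, hLc.closure, ?_, ?_, hE⟩
  · exact ((isCompact_closedBall (0 : Eu n) (m:ℝ)).of_isClosed_subset isClosed_closure
      (closure_minimal Set.inter_subset_right Metric.isClosed_closedBall))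
  · exact hm.le.trans (measure_mono subset_closure)
  · simpa using hE Set.univ

lemma lc_main (hn : 1 ≤ n) (hf : IsLogConcave f) (h1 : ∫⁻ x, ENNReal.ofReal (f x) = 1)
    (hs : 1 ≤ essSup (fun x => ENNReal.ofReal (f x)) volume) :
    ∃ (T : Eu n ≃ₗ[ℝ] Eu n) (b : Eu n) (ρ : ℝ), 0 < ρ ∧
      volume ((fun u => b + T u) '' Metric.ball 0 ρ) = 1 ∧
      ENNReal.ofReal ((1024 * rexp 2 * (192 * rexp 7))⁻¹ ^ n) ≤
        ∫⁻ x in (fun u => b + T u) '' Metric.ball 0 ρ, ENNReal.ofReal (f x) := by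
  obtain ⟨x0, hM2, hfM⟩ := lc_peak hf h1 hs
  have hhalf := lc_half hf x0
  set M := f x0 with hM
  have hMpos : 0 < M := by linarith
  set I := ∫⁻ x, ENNReal.ofReal (√(f x)) with hI
  set s : ℝ := √M * (2 ^ n)⁻¹ / 2 with hsdef
  have hspos : 0 < s := by positivity
  set t : ℝ := s ^ 2 with htdef
  have htpos : 0 < t := by positivity
  have ht : t = M * (4 ^ n)⁻¹ / 4 := by
    rw [htdef, hsdef, div_pow, mul_pow, Real.sq_sqrt hMpos.le, inv_pow, ← pow_mul, mul_comm n 2, pow_mul]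
    norm_num
  set K0 := {x | t ≤ f x} with hK0
  have hcv : Convex ℝ K0 := lc_convex hf htpos
  have hnm : NullMeasurableSet K0 volume := hcv.nullMeasurableSet _
  -- upper bound on volume
  have hup : ENNReal.ofReal t * volume K0 ≤ 1 := by
    rw [← h1, ← lintegral_indicator_const₀ hnm]
    apply lintegral_mono
    intro x
    by_cases hx : x ∈ K0
    · rw [Set.indicator_of_mem hx]
      exact ENNReal.ofReal_le_ofReal hx
    · rw [Set.indicator_of_notMem hx]; exact zero_le
  have ht0 : ENNReal.ofReal t ≠ 0 := by simpa using htpos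
  have hVt : volume K0 ≠ ⊤ := by
    intro h
    rw [h, ENNReal.mul_top ht0] at hup
    exact absurd hup (by simp)
  -- lower bound on volume
  have hlow : (1:ENNReal) ≤ ENNReal.ofReal (2 * M) * volume K0 + ENNReal.ofReal s * I := by
    rw [← h1, hI, ← lintegral_const_mul' _ _ ENNReal.ofReal_ne_top, ← lintegral_indicator_const₀ hnm,
      ← lintegral_add_left' (aemeasurable_const.indicator₀ hnm)]
    apply lintegral_mono
    intro x
    by_cases hx : x ∈ K0
    · simp only [Set.indicator_of_mem hx]
      exact le_add_of_le_of_nonneg (ENNReal.ofReal_le_ofReal (hfM x)) zero_le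
    · simp only [Set.indicator_of_notMem hx, zero_add]
      rw [← ENNReal.ofReal_mul hspos.le]
      apply ENNReal.ofReal_le_ofReal
      have hx' : f x < t := by simpa [hK0] using hx
      have h3 : √(f x) ≤ s := by
        rw [Real.sqrt_le_left hspos.le]; exact hx'.le
      calc f x = √(f x) * √(f x) := (Real.mul_self_sqrt (hf.1 x)).symm
        _ ≤ _ := by gcongr
  have hsI : ENNReal.ofReal s * I ≤ ENNReal.ofReal (1/2) := by
    have : s = ((2 ^ n)⁻¹ / 2) * √M := by rw [hsdef]; ring
    rw [this, ENNReal.ofReal_mul (by positivity), mul_assoc]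
    refine (mul_le_mul_right hhalf _).trans ?_
    rw [h1, mul_one, ← ENNReal.ofReal_mul (by positivity)]
    apply le_of_eq; congr 1; field_simp
  set v := (volume K0).toReal with hv
  have hVv : volume K0 = ENNReal.ofReal v := (ENNReal.ofReal_toReal hVt).symm
  have hv0 : 0 ≤ v := ENNReal.toReal_nonneg
  have hlow' : 1 / 2 ≤ 2 * M * v := by
    have := hlow.trans (add_le_add_right hsI _)
    rw [hVv, ← ENNReal.ofReal_mul (by positivity), ← ENNReal.ofReal_add (by positivity) (by positivity), ENNReal.one_le_ofReal] at this
    linarith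
  have hup' : t * v ≤ 1 := by
    rw [hVv, ← ENNReal.ofReal_mul (by positivity), ENNReal.ofReal_le_one] at hup
    exact hup
  have hvpos : 0 < v := by
    by_contra hc
    have : v = 0 := le_antisymm (not_lt.1 hc) hv0
    rw [this] at hlow'; norm_num at hlow'
  have hV0 : volume K0 ≠ 0 := by rw [hVv]; simpa using hvpos
  obtain ⟨K, hKc, hKcv, hKl, hKu, hKE⟩ := exists_trunc hcv hV0 hVt
  have hK0' : volume K ≠ 0 := by
    intro h
    rw [h] at hKl
    have := ENNReal.half_pos hV0
    exact absurd this (not_lt.2 hKl)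
  have hv32 : v ≤ 32 ^ n := by
    rw [ht] at hup'
    have h4 : (0:ℝ) < 4 ^ n := by positivity
    have h5 : M * v ≤ 4 * 4 ^ n := by
      have : M * v = (M * (4 ^ n)⁻¹ / 4 * v) * (4 * 4 ^ n) := by field_simp
      rw [this]
      have := mul_le_mul_of_nonneg_right hup' (show (0:ℝ) ≤ 4 * 4 ^ n by positivity)
      linarith
    have h6 : v ≤ 8 * 4 ^ n := by nlinarith
    refine h6.trans ?_
    rw [show (32:ℝ) = 8 * 4 by norm_num, mul_pow]
    gcongr
    exact le_self_pow₀ (by norm_num) (by omega)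
  obtain ⟨T, b, ρ, hρ, hE1, hE2⟩ := exists_unit_ellipsoid hn hKc hKcv hK0' 
    (hKu.trans (by rw [hVv]; exact ENNReal.ofReal_le_ofReal hv32))
  refine ⟨T, b, ρ, hρ, hE1, ?_⟩
  set E := (fun u => b + T u) '' Metric.ball 0 ρ with hE
  have hEm : MeasurableSet E := by
    have : E = (fun x => T.symm (x - b)) ⁻¹' Metric.ball 0 ρ := by
      ext x
      constructor
      · rintro ⟨u, hu, rfl⟩
        simpa using hu
      · intro hx
        exact ⟨T.symm (x - b), hx, by simp⟩
    rw [this]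
    apply (Metric.isOpen_ball.preimage _).measurableSet
    exact (T.symm : Eu n →ₗ[ℝ] Eu n).continuous_of_finiteDimensional.comp (continuous_id.sub continuous_const)
  have hfin : ENNReal.ofReal t * volume (K0 ∩ E) ≤ ∫⁻ x in E, ENNReal.ofReal (f x) := by
    rw [← Measure.restrict_apply' hEm, ← lintegral_indicator_const₀ (hnm.mono_ac Measure.restrict_le_self.absolutelyContinuous)]
    apply lintegral_mono
    intro x
    by_cases hx : x ∈ K0
    · rw [Set.indicator_of_mem hx]
      exact ENNReal.ofReal_le_ofReal hx
    · rw [Set.indicator_of_notMem hx]; exact zero_le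
  refine le_trans ?_ hfin
  set Q : ℝ := (8 * rexp 2 * (192 * rexp 7)) with hQ
  have hQpos : 0 < Q := by positivity
  have hwt : volume (K0 ∩ E) ≠ ⊤ := ((measure_mono Set.inter_subset_left).trans_lt hVt.lt_top).ne
  set w := (volume (K0 ∩ E)).toReal with hw
  have hww : volume (K0 ∩ E) = ENNReal.ofReal w := (ENNReal.ofReal_toReal hwt).symm
  have hw0 : 0 ≤ w := ENNReal.toReal_nonneg
  have hvw : v / 2 ≤ Q ^ n * w := by
    have h7 := hKl.trans (hE2.trans (mul_le_mul_right (hKE E) _))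
    rw [hww, hVv, ← ENNReal.ofReal_mul (by positivity), show (2:ENNReal) = ENNReal.ofReal 2 by simp,
      ← ENNReal.ofReal_div_of_pos (by norm_num), ENNReal.ofReal_le_ofReal_iff (by positivity)] at h7
    exact h7
  rw [hww, ← ENNReal.ofReal_mul htpos.le]
  apply ENNReal.ofReal_le_ofReal
  have h8 : 1 / 8 ≤ Q ^ n * (M * w) := by nlinarith
  have h9 : (1024 * rexp 2 * (192 * rexp 7)) = 128 * Q := by rw [hQ]; ring
  rw [h9, inv_pow, mul_pow, ht]
  rw [inv_le_iff_one_le_mul₀ (by positivity)]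
  have h10 : (32:ℝ) * 4 ^ n ≤ 128 ^ n := by
    rw [show (128:ℝ) = 32 * 4 by norm_num, mul_pow]
    gcongr
    exact le_self_pow₀ (by norm_num) (by omega)
  have h11 : M * (4 ^ n)⁻¹ / 4 * w * (128 ^ n * Q ^ n) = (Q ^ n * (M * w)) * (128 ^ n * (4 ^ n)⁻¹ / 4) := by ring
  rw [h11]
  have h12 : (8:ℝ) ≤ 128 ^ n * (4 ^ n)⁻¹ / 4 := by
    rw [← div_eq_mul_inv, le_div_iff₀ (by norm_num), le_div_iff₀ (by positivity)]; linarith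
  calc (1:ℝ) = 1 / 8 * 8 := by norm_num
    _ ≤ _ := by gcongr
end F2


/-- Existence of M-ellipsoids for log-concave measures: there is a universal
constant `c_M ∈ (0,1)` such that every log-concave probability measure `μ` on ℝⁿ
whose density `f` satisfies `‖f‖_∞ ≥ 1` gives mass at least `c_M ^ n` to some
ellipsoid (image of a Euclidean ball under an invertible affine map) of volume 1. -/
theorem exists_M_ellipsoid :
    ∃ cM : ℝ, 0 < cM ∧ cM < 1 ∧
    ∀ (n : ℕ), 1 ≤ n →
    ∀ (μ : Measure (EuclideanSpace ℝ (Fin n)))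
      (f : EuclideanSpace ℝ (Fin n) → ℝ),
      IsProbabilityMeasure μ →
      μ = volume.withDensity (fun x => ENNReal.ofReal (f x)) →
      IsLogConcave f →
      1 ≤ essSup (fun x => ENNReal.ofReal (f x)) volume →
      ∃ (T : EuclideanSpace ℝ (Fin n) ≃ᵃ[ℝ] EuclideanSpace ℝ (Fin n)) (r : ℝ),
        0 < r ∧
        volume ((⇑T) '' Metric.ball (0 : EuclideanSpace ℝ (Fin n)) r) = 1 ∧
        cM ≤ (μ ((⇑T) '' Metric.ball (0 : EuclideanSpace ℝ (Fin n)) r)).toReal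
              ^ ((1 : ℝ) / n) := by
  refine ⟨(1024 * rexp 2 * (192 * rexp 7))⁻¹, by positivity, ?_, ?_⟩
  · apply inv_lt_one_of_one_lt₀
    have h2 := Real.add_one_le_exp (2:ℝ)
    have h7 := Real.add_one_le_exp (7:ℝ)
    nlinarith
  · intro n hn μ f hprob hμ hf hs
    have h1 : ∫⁻ x, ENNReal.ofReal (f x) = 1 := by
      have := hprob.measure_univ
      rwa [hμ, withDensity_apply _ MeasurableSet.univ, Measure.restrict_univ] at this
    obtain ⟨T, b, ρ, hρ, hE1, hE2⟩ := lc_main hn hf h1 hs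
    have himg : (⇑(T.toAffineEquiv.trans (AffineEquiv.constVAdd ℝ (Eu n) b))) '' Metric.ball (0 : Eu n) ρ
        = (fun u => b + T u) '' Metric.ball 0 ρ := rfl
    refine ⟨T.toAffineEquiv.trans (AffineEquiv.constVAdd ℝ (Eu n) b), ρ, hρ, ?_, ?_⟩
    · rw [himg]; exact hE1
    · rw [himg]
      set E := (fun u => b + T u) '' Metric.ball 0 ρ with hE
      have h3 : ENNReal.ofReal ((1024 * rexp 2 * (192 * rexp 7))⁻¹ ^ n) ≤ μ E := by
        rw [hμ]
        exact hE2.trans (withDensity_apply_le _ _)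
      have h4 : (1024 * rexp 2 * (192 * rexp 7))⁻¹ ^ n ≤ (μ E).toReal :=
        (ENNReal.ofReal_le_iff_le_toReal (measure_ne_top μ E)).1 h3
      calc (1024 * rexp 2 * (192 * rexp 7))⁻¹
          = ((1024 * rexp 2 * (192 * rexp 7))⁻¹ ^ n) ^ ((1:ℝ) / n) := by
            rw [one_div, Real.pow_rpow_inv_natCast (by positivity) (by omega)]
        _ ≤ _ := by gcongr
end
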